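/- arXiv:2009.08903 — 8 statements merged into one kernel-verified Lean document; each statement's English description precedes it below -/
import Mathlib

section
/- For any digraph D without parallel edges, bcrk(L⃗(D))/2 − 1 ≤ dbw(D) ≤ 8·(1 + 2^{bcrk(L⃗(D))}). Consequently, a class of digraphs without parallel edges has bounded directed branch-width if and only if the class of its directed line-graphs has bounded bi-cut-rank-width. -/
open scoped Classical

/-! ### Basic digraph notions -/

/-- The set of directed edges of a digraph, as ordered pairs. -/
def Digraph.edgeSet' {V : Type} (D : Digraph V) : Set (V × V) := {p | D.Adj p.1 p.2}

/-- The underlying undirected graph of a digraph. -/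
def underlying {V : Type} (D : Digraph V) : SimpleGraph V := SimpleGraph.fromRel D.Adj

/-- A source: a vertex with no incoming edge. -/
def IsSource {V : Type} (D : Digraph V) (x : V) : Prop := ∀ w, ¬ D.Adj w x

/-- A sink: a vertex with no outgoing edge. -/
def IsSink {V : Type} (D : Digraph V) (x : V) : Prop := ∀ z, ¬ D.Adj x z

/-- Delete the edge `x→y` from `D`. -/
def Digraph.deleteEdge {V : Type} (D : Digraph V) (x y : V) : Digraph V where
  Adj a b := D.Adj a b ∧ ¬(a = x ∧ b = y)

/-! ### Separators and directed branch-width -/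

/-- Directed vertex separator of the edge partition `(E(D) \ X, X)`: vertices `y` admitting
an edge `x→y` of `E(D) \ X` and an edge `y→z` of `X`. -/
def dirSep {V : Type} (D : Digraph V) (X : Set (V × V)) : Set V :=
  {y | ∃ x z : V, D.Adj x y ∧ (x, y) ∉ X ∧ D.Adj y z ∧ (y, z) ∈ X}

/-- The bidirected separator of the edge partition `(E(D) \ X, X)`: the union of the
directed vertex separators of `(E(D) \ X, X)` and of `(X, E(D) \ X)`. -/
def biSep {V : Type} (D : Digraph V) (X : Set (V × V)) : Set V :=
  dirSep D X ∪ dirSep D (D.edgeSet' \ X)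

/-- Leaves of a graph: vertices with at most one neighbour. -/
def leaves {T : Type} (G : SimpleGraph T) : Set T := {t | (G.neighborSet t).Subsingleton}

/-- The vertices on the `b`-side of the edge `ab` of a tree: those reachable from `b`
after deleting the edge `ab`. -/
def side {T : Type} (G : SimpleGraph T) (a b : T) : Set T :=
  {t | (G.deleteEdges {s(a, b)}).Reachable b t}

/-- Maximum degree at most three. -/
def maxDegLE3 {T : Type} (G : SimpleGraph T) : Prop := ∀ t, (G.neighborSet t).ncard ≤ 3

/-- `D` has a directed branch decomposition of width at most `k`: a tree of maximum degree
three whose leaves are in bijection with `E(D)`, every edge of which induces an edge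
partition whose bidirected separator has at most `k` elements. -/
def dbwLE {V : Type} (D : Digraph V) (k : ℕ) : Prop :=
  ∃ (m : ℕ) (G : SimpleGraph (Fin m)) (β : Fin m → V × V),
    G.IsTree ∧ maxDegLE3 G ∧ Set.BijOn β (leaves G) D.edgeSet' ∧
    ∀ a b : Fin m, G.Adj a b →
      (biSep D (β '' (leaves G ∩ side G a b))).ncard ≤ k

/-- Directed branch-width. -/
noncomputable def dbw {V : Type} (D : Digraph V) : ℕ := sInf {k | dbwLE D k}

/-! ### Directed line graph and bi-cut-rank-width -/

/-- The directed line graph of `D`: vertices are the edges of `D`, with an edge `e→f`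
whenever `e` ends where `f` starts. -/
def dirLineGraph {V : Type} (D : Digraph V) : Digraph {e : V × V // D.Adj e.1 e.2} where
  Adj e f := e.val.2 = f.val.1

/-- The GF(2) adjacency matrix of a digraph, as a function. -/
noncomputable def adjFun {W : Type} (H : Digraph W) (a b : W) : ZMod 2 :=
  if H.Adj a b then 1 else 0

/-- The rank over GF(2) of the submatrix `M[A, B]` of the adjacency matrix of `H`:
the dimension of the span of the rows indexed by `A`, restricted to the columns `B`. -/
noncomputable def cutrk {W : Type} (H : Digraph W) (A B : Set W) : ℕ :=
  Module.finrank (ZMod 2)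
    (Submodule.span (ZMod 2) ((fun a : W => fun b : B => adjFun H a (b : W)) '' A))

/-- `H` has a bi-cut-rank decomposition of width at most `k`: a tree of maximum degree
three whose leaves are in bijection with `V(H)`, each edge of which induces a vertex
partition `(V(H) \ X, X)` with `rk M[V(H) \ X, X] + rk M[X, V(H) \ X] ≤ k`. -/
def bcrkLE {W : Type} (H : Digraph W) (k : ℕ) : Prop :=
  ∃ (m : ℕ) (G : SimpleGraph (Fin m)) (β : Fin m → W),
    G.IsTree ∧ maxDegLE3 G ∧ Set.BijOn β (leaves G) Set.univ ∧
    ∀ a b : Fin m, G.Adj a b →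
      cutrk H (β '' (leaves G ∩ side G a b))ᶜ (β '' (leaves G ∩ side G a b)) +
        cutrk H (β '' (leaves G ∩ side G a b)) (β '' (leaves G ∩ side G a b))ᶜ ≤ k

/-- Bi-cut-rank-width. -/
noncomputable def bcrk {W : Type} (H : Digraph W) : ℕ := sInf {k | bcrkLE H k}

/-! ### Undirected branch-width -/

/-- The vertices of `G` incident both with an edge outside `X` and with an edge in `X`. -/
def usep {V : Type} (G : SimpleGraph V) (X : Set (Sym2 V)) : Set V :=
  {v | (∃ e ∈ G.edgeSet \ X, v ∈ e) ∧ (∃ e ∈ X, v ∈ e)}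

/-- `G` has an (undirected) branch decomposition of width at most `k`. -/
def bwLE {V : Type} (G : SimpleGraph V) (k : ℕ) : Prop :=
  ∃ (m : ℕ) (T : SimpleGraph (Fin m)) (β : Fin m → Sym2 V),
    T.IsTree ∧ maxDegLE3 T ∧ Set.BijOn β (leaves T) G.edgeSet ∧
    ∀ a b : Fin m, T.Adj a b →
      (usep G (β '' (leaves T ∩ side T a b))).ncard ≤ k

/-- Branch-width of an undirected graph. -/
noncomputable def bw {V : Type} (G : SimpleGraph V) : ℕ := sInf {k | bwLE G k}

/-! ### Source-sink identification -/

/-- Identify the vertex `y` into the vertex `x`; the vertex `y` is kept, but becomes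
an isolated vertex. -/
def identify {V : Type} (D : Digraph V) (x y : V) : Digraph V where
  Adj a b := a ≠ y ∧ b ≠ y ∧
    ∃ a' b', (if a' = y then x else a') = a ∧ (if b' = y then x else b') = b ∧ D.Adj a' b'

/-- One identification of a pair of distinct source/sink-identifiable vertices. -/
def identStep {V : Type} (D D' : Digraph V) : Prop :=
  ∃ x y, x ≠ y ∧
    ((IsSource D x ∧ IsSource D y) ∨ (IsSink D x ∧ IsSink D y)) ∧
    D' = identify D x y

/-! ### Minors -/

/-- Contract the edge `x→y`: the two endpoints are merged into `x`, while `y` is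
kept as an isolated vertex. -/
def contractEdge {V : Type} (D : Digraph V) (x y : V) : Digraph V where
  Adj a b := a ≠ y ∧ b ≠ y ∧
    ∃ a' b', (if a' = y then x else a') = a ∧ (if b' = y then x else b') = b ∧
      D.Adj a' b' ∧ ¬(a' = x ∧ b' = y)

/-- The number of edges incident with `v`. -/
noncomputable def degree' {V : Type} (D : Digraph V) (v : V) : ℕ :=
  {e ∈ D.edgeSet' | v = e.1 ∨ v = e.2}.ncard

/-- The vertices incident with at least three edges. -/
def V3 {V : Type} (D : Digraph V) : Set V := {v | 3 ≤ degree' D v}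

/-- The edge `x→y` is 2-contractible. -/
def TwoContractible {V : Type} (D : Digraph V) (x y : V) : Prop :=
  D.Adj x y ∧ ¬(({x, y} : Set V) ⊆ V3 D) ∧
  (D.Adj y x ∨
    ¬∃ w z, w ∈ V3 D ∧ z ∈ V3 D ∧
      Relation.ReflTransGen (D.deleteEdge x y).Adj x w ∧
      Relation.ReflTransGen (D.deleteEdge x y).Adj z y)

/-- One contraction of a 2-contractible edge. -/
def topStep {V : Type} (D D' : Digraph V) : Prop :=
  ∃ x y, TwoContractible D x y ∧ D' = contractEdge D x y

/-- `H` is a directed topological minor of `D`: it is obtained from a subgraph of `D` by a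
sequence of contractions of 2-contractible edges. -/
def DirTopMinor {V : Type} (H D : Digraph V) : Prop :=
  ∃ D₀ : Digraph V, (∀ ⦃a b⦄, D₀.Adj a b → D.Adj a b) ∧ Relation.ReflTransGen topStep D₀ H

/-- The edge `x→y` is a butterfly edge: `x` has out-degree 1 and `y` has in-degree 1. -/
def ButterflyEdge {V : Type} (D : Digraph V) (x y : V) : Prop :=
  D.Adj x y ∧ (∀ z, D.Adj x z → z = y) ∧ (∀ w, D.Adj w y → w = x)

/-- One contraction of a butterfly edge. -/
def butterflyStep {V : Type} (D D' : Digraph V) : Prop :=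
  ∃ x y, ButterflyEdge D x y ∧ D' = contractEdge D x y

/-- `H` is a butterfly minor of `D`: it is obtained from a subgraph of `D` by a sequence of
contractions of butterfly edges. -/
def ButterflyMinor {V : Type} (H D : Digraph V) : Prop :=
  ∃ D₀ : Digraph V, (∀ ⦃a b⦄, D₀.Adj a b → D.Adj a b) ∧ Relation.ReflTransGen butterflyStep D₀ H

/-! ### Directed cuts and consistency -/

/-- Directed order of a vertex partition `(V(D) \ Z, Z)`: the number of edges starting
outside `Z` and ending in `Z`. -/
noncomputable def dirOrder {V : Type} (D : Digraph V) (Z : Set V) : ℕ :=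
  {e : V × V | D.Adj e.1 e.2 ∧ e.1 ∉ Z ∧ e.2 ∈ Z}.ncard

/-- `(A, B)` is `(lA, lB)`-consistent: vertices of `A` with the same `lA`-label have the same
out-neighbours in `B`, and vertices of `B` with the same `lB`-label have the same
in-neighbours in `A`. -/
def Consistent {W S : Type} (H : Digraph W) (A B : Set W) (lA lB : W → S) : Prop :=
  (∀ a₁ ∈ A, ∀ a₂ ∈ A, lA a₁ = lA a₂ → ∀ b ∈ B, (H.Adj a₁ b ↔ H.Adj a₂ b)) ∧
  (∀ b₁ ∈ B, ∀ b₂ ∈ B, lB b₁ = lB b₂ → ∀ a ∈ A, (H.Adj a b₁ ↔ H.Adj a b₂))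

theorem cutrk_eq_aux {V : Type} [Fintype V] (D : Digraph V)
    (X : Set {e : V × V // D.Adj e.1 e.2}) :
    cutrk (dirLineGraph D) Xᶜ X = (dirSep D (Subtype.val '' X)).ncard := by
  set S := dirSep D (Subtype.val '' X) with hS
  let r : S → (X → ZMod 2) := fun y b => if (y : V) = b.1.1.1 then 1 else 0
  have hli : LinearIndependent (ZMod 2) r := by
    rw [Fintype.linearIndependent_iff]
    intro g hg y
    obtain ⟨x, z, h1, h2, h3, ⟨b, hb, hbe⟩⟩ := y.2
    have := congrFun hg ⟨b, hb⟩
    rw [Finset.sum_apply, Finset.sum_eq_single y] at this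
    · simpa [r, hbe] using this
    · intro y' _ hne
      have : (y' : V) ≠ y := fun h => hne (Subtype.ext h)
      simp [r, hbe, this]
    · simp
  have hspan : Submodule.span (ZMod 2)
      ((fun a : {e : V × V // D.Adj e.1 e.2} => fun b : X =>
        adjFun (dirLineGraph D) a (b : {e : V × V // D.Adj e.1 e.2})) '' Xᶜ)
      = Submodule.span (ZMod 2) (Set.range r) := by
    apply le_antisymm
    · rw [Submodule.span_le]
      rintro _ ⟨a, ha, rfl⟩
      by_cases hy : a.1.2 ∈ S
      · exact Submodule.subset_span ⟨⟨a.1.2, hy⟩, rfl⟩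
      · suffices h0 : (fun b : X => adjFun (dirLineGraph D) a
            (b : {e : V × V // D.Adj e.1 e.2})) = 0 by
          show (fun b : X => adjFun (dirLineGraph D) a
            (b : {e : V × V // D.Adj e.1 e.2})) ∈ Submodule.span (ZMod 2) (Set.range r)
          rw [h0]
          exact Submodule.zero_mem _
        funext b
        have : ¬ a.1.2 = b.1.1.1 := by
          intro h
          apply hy
          refine ⟨a.1.1, b.1.1.2, a.2, ?_, ?_, ?_⟩
          · rintro ⟨a', ha', he⟩
            have : a' = a := Subtype.ext he
            exact ha (this ▸ ha')
          · rw [h]; exact b.1.2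
          · rw [h]; exact ⟨b.1, b.2, rfl⟩
        simp [adjFun, dirLineGraph, this]
    · rw [Submodule.span_le]
      rintro _ ⟨y, rfl⟩
      obtain ⟨x, z, h1, h2, h3, h4⟩ := y.2
      apply Submodule.subset_span
      refine ⟨⟨(x, y), h1⟩, fun h => h2 ⟨_, h, rfl⟩, ?_⟩
      rfl
  unfold cutrk
  rw [hspan, finrank_span_eq_card hli, ← Nat.card_eq_fintype_card, Nat.card_coe_set_eq]

theorem cutrk_sum_aux {V : Type} [Fintype V] (D : Digraph V)
    (X : Set {e : V × V // D.Adj e.1 e.2}) :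
    (biSep D (Subtype.val '' X)).ncard ≤
      cutrk (dirLineGraph D) Xᶜ X + cutrk (dirLineGraph D) X Xᶜ ∧
    cutrk (dirLineGraph D) Xᶜ X + cutrk (dirLineGraph D) X Xᶜ ≤
      2 * (biSep D (Subtype.val '' X)).ncard := by
  have h1 := cutrk_eq_aux D X
  have h2 := cutrk_eq_aux D Xᶜ
  rw [compl_compl] at h2
  have h3 : (Subtype.val '' Xᶜ : Set (V × V)) = D.edgeSet' \ (Subtype.val '' X) := by
    ext e
    constructor
    · rintro ⟨a, ha, rfl⟩
      refine ⟨a.2, ?_⟩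
      rintro ⟨b, hb, h⟩
      exact ha (Subtype.ext h ▸ hb)
    · rintro ⟨he, hn⟩
      exact ⟨⟨e, he⟩, fun h => hn ⟨_, h, rfl⟩, rfl⟩
  rw [h3] at h2
  rw [h1, h2]
  unfold biSep
  refine ⟨Set.ncard_union_le _ _, ?_⟩
  have h4 := Set.ncard_le_ncard (s := dirSep D (Subtype.val '' X))
    (t := dirSep D (Subtype.val '' X) ∪ dirSep D (D.edgeSet' \ (Subtype.val '' X)))
    Set.subset_union_left (Set.toFinite _)
  have h5 := Set.ncard_le_ncard (s := dirSep D (D.edgeSet' \ (Subtype.val '' X)))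
    (t := dirSep D (Subtype.val '' X) ∪ dirSep D (D.edgeSet' \ (Subtype.val '' X)))
    Set.subset_union_right (Set.toFinite _)
  omega

theorem dbwLE_of_bcrkLE_aux {V : Type} [Fintype V] (D : Digraph V) (k : ℕ)
    (h : bcrkLE (dirLineGraph D) k) : dbwLE D k := by
  obtain ⟨m, G, β, hT, hd, hb, hw⟩ := h
  refine ⟨m, G, fun i => (β i).1, hT, hd, ⟨fun i _ => (β i).2, ?_, ?_⟩, ?_⟩
  · intro i hi j hj hij
    exact hb.injOn hi hj (Subtype.ext hij)
  · intro e he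
    obtain ⟨i, hi, hie⟩ := hb.surjOn (Set.mem_univ (⟨e, he⟩ : {e : V × V // D.Adj e.1 e.2}))
    exact ⟨i, hi, congrArg Subtype.val hie⟩
  · intro a b hab
    have h1 := (cutrk_sum_aux D (β '' (leaves G ∩ side G a b))).1
    rw [Set.image_image] at h1
    exact h1.trans (hw a b hab)

theorem bcrkLE_of_dbwLE_aux {V : Type} [Fintype V] (D : Digraph V) (k : ℕ)
    (e₀ : {e : V × V // D.Adj e.1 e.2})
    (h : dbwLE D k) : bcrkLE (dirLineGraph D) (2 * k) := by
  obtain ⟨m, G, β, hT, hd, hb, hw⟩ := h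
  let γ : Fin m → {e : V × V // D.Adj e.1 e.2} := fun i =>
    if hi : D.Adj (β i).1 (β i).2 then ⟨β i, hi⟩ else e₀
  have hγ : ∀ i ∈ leaves G, (γ i).1 = β i := by
    intro i hi
    have : D.Adj (β i).1 (β i).2 := hb.mapsTo hi
    simp [γ, this]
  refine ⟨m, G, γ, hT, hd, ⟨fun i _ => Set.mem_univ _, ?_, ?_⟩, ?_⟩
  · intro i hi j hj hij
    apply hb.injOn hi hj
    rw [← hγ i hi, ← hγ j hj, hij]
  · intro e _
    obtain ⟨i, hi, hie⟩ := hb.surjOn (show e.1 ∈ D.edgeSet' from e.2)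
    exact ⟨i, hi, Subtype.ext ((hγ i hi).trans hie)⟩
  · intro a b hab
    have h1 := (cutrk_sum_aux D (γ '' (leaves G ∩ side G a b))).2
    rw [Set.image_image, Set.image_congr (fun i hi => hγ i hi.1)] at h1
    have := hw a b hab
    omega

theorem dbw_bcrk_aux {V : Type} [Fintype V] (D : Digraph V) :
    dbw D ≤ bcrk (dirLineGraph D) ∧ bcrk (dirLineGraph D) ≤ 2 * dbw D := by
  rcases isEmpty_or_nonempty {e : V × V // D.Adj e.1 e.2} with hE | ⟨⟨e₀⟩⟩
  · have h1 : bcrk (dirLineGraph D) = 0 := by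
      have : {k | bcrkLE (dirLineGraph D) k} = ∅ := by
        ext k
        simp only [Set.mem_ofPred_eq, Set.mem_empty_iff_false, iff_false]
        rintro ⟨m, G, β, hT, -⟩
        obtain ⟨i⟩ := hT.connected.nonempty
        exact hE.elim (β i)
      simp [bcrk, this]
    have h2 : dbw D = 0 := by
      unfold dbw
      rcases Set.eq_empty_or_nonempty {k | dbwLE D k} with h | ⟨k, m, G, β, hT, hd, hb, -⟩
      · simp [h]
      · apply Nat.sInf_eq_zero.2
        left
        refine ⟨m, G, β, hT, hd, hb, fun a b _ => ?_⟩
        have : biSep D (β '' (leaves G ∩ side G a b)) = ∅ := by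
          ext y
          simp only [Set.mem_empty_iff_false, iff_false]
          rintro (⟨x, z, h, -⟩ | ⟨x, z, h, -⟩) <;> exact hE.elim ⟨(x, y), h⟩
        simp [this]
    simp [h1, h2]
  · constructor
    · rcases Set.eq_empty_or_nonempty {k | bcrkLE (dirLineGraph D) k} with h | h
      · have : {k | dbwLE D k} = ∅ := by
          ext k
          simp only [Set.mem_ofPred_eq, Set.mem_empty_iff_false, iff_false]
          intro hk
          have : 2 * k ∈ {k | bcrkLE (dirLineGraph D) k} := bcrkLE_of_dbwLE_aux D k e₀ hk
          simp [h] at this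
        simp [dbw, this]
      · exact Nat.sInf_le (dbwLE_of_bcrkLE_aux D _ (Nat.sInf_mem h))
    · rcases Set.eq_empty_or_nonempty {k | dbwLE D k} with h | h
      · have : {k | bcrkLE (dirLineGraph D) k} = ∅ := by
          ext k
          simp only [Set.mem_ofPred_eq, Set.mem_empty_iff_false, iff_false]
          intro hk
          have : k ∈ {k | dbwLE D k} := dbwLE_of_bcrkLE_aux D k hk
          simp [h] at this
        simp [bcrk, this]
      · exact Nat.sInf_le (bcrkLE_of_dbwLE_aux D _ e₀ (Nat.sInf_mem h))


/-- For any digraph `D` (without parallel edges),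
`bcrk(L⃗(D))/2 − 1 ≤ dbw(D) ≤ 8·(1 + 2^{bcrk(L⃗(D))})`; consequently, a class of digraphs
has bounded directed branch-width iff the class of its directed line graphs has bounded
bi-cut-rank-width. -/
theorem dbw_iff_bcrk_of_dirLineGraph :
    (∀ (V : Type) (_ : Fintype V) (D : Digraph V),
        bcrk (dirLineGraph D) / 2 - 1 ≤ dbw D ∧
        dbw D ≤ 8 * (1 + 2 ^ bcrk (dirLineGraph D))) ∧
    (∀ (ι : Type) (V : ι → Type) (_ : ∀ i, Fintype (V i)) (Ds : ∀ i, Digraph (V i)),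
        (∃ c : ℕ, ∀ i, dbw (Ds i) ≤ c) ↔
        (∃ c : ℕ, ∀ i, bcrk (dirLineGraph (Ds i)) ≤ c)) := by
  refine ⟨fun V _ D => ?_, fun ι V _ Ds => ⟨?_, ?_⟩⟩
  · obtain ⟨h1, h2⟩ := dbw_bcrk_aux D
    have h3 : bcrk (dirLineGraph D) < 2 ^ bcrk (dirLineGraph D) := Nat.lt_two_pow_self
    constructor <;> omega
  · rintro ⟨c, hc⟩
    refine ⟨2 * c, fun i => ?_⟩
    have := (dbw_bcrk_aux (Ds i)).2
    have := hc i
    omega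
  · rintro ⟨c, hc⟩
    exact ⟨c, fun i => (dbw_bcrk_aux (Ds i)).1.trans (hc i)⟩
end

section
/- Let D be a digraph and k a natural number. If dbw(D) ≤ k, then bcrk(L⃗(D)) ≤ 2(k + 1). -/
open scoped Classical

theorem cutrk_le_ncard_aux {V : Type} [Fintype V] (D : Digraph V)
    (A B : Set {e : V × V // D.Adj e.1 e.2}) (S : Set V)
    (hS : ∀ a ∈ A, ∀ b ∈ B, a.val.2 = b.val.1 → a.val.2 ∈ S) :
    cutrk (dirLineGraph D) A B ≤ S.ncard := by
  classical
  let g : V → (B → ZMod 2) := fun v b => if v = b.val.val.1 then 1 else 0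
  let F : Finset (B → ZMod 2) := S.toFinset.image g
  have h1 : Submodule.span (ZMod 2)
      ((fun a => fun b : B => adjFun (dirLineGraph D) a (b : _)) '' A) ≤
      Submodule.span (ZMod 2) (F : Set (B → ZMod 2)) := by
    rw [Submodule.span_le]
    rintro _ ⟨a, ha, rfl⟩
    by_cases hs : a.val.2 ∈ S
    · apply Submodule.subset_span
      simp only [F, Finset.coe_image, Set.coe_toFinset]
      refine ⟨a.val.2, hs, ?_⟩
      funext b
      simp only [g, adjFun, dirLineGraph]
      congr
    · have : (fun b : B => adjFun (dirLineGraph D) a (b : _)) = 0 := by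
        funext b
        have : ¬ a.val.2 = b.val.val.1 := fun h => hs (hS a ha b b.2 h)
        simp [adjFun, dirLineGraph, this]
      simp only [this]
      exact Submodule.zero_mem _
  calc cutrk (dirLineGraph D) A B
      ≤ Module.finrank (ZMod 2) (Submodule.span (ZMod 2) (F : Set (B → ZMod 2))) :=
        Submodule.finrank_mono h1
    _ ≤ F.card := finrank_span_finset_le_card F
    _ ≤ S.toFinset.card := Finset.card_image_le
    _ = S.ncard := (Set.ncard_eq_toFinset_card' S).symm

/-- If `dbw(D) ≤ k`, then `bcrk(L⃗(D)) ≤ 2(k + 1)`. -/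
theorem bcrk_dirLineGraph_le_of_dbw_le {V : Type} [Fintype V] (D : Digraph V) (k : ℕ)
    (h : dbw D ≤ k) : bcrk (dirLineGraph D) ≤ 2 * (k + 1) := by
  by_cases hb : {k | bcrkLE (dirLineGraph D) k}.Nonempty
  swap
  · rw [Set.not_nonempty_iff_eq_empty] at hb
    simp [bcrk, hb]
  obtain ⟨k₀, m₀, G₀, β₀, hT₀, hd₀, hβ₀, -⟩ := hb
  obtain ⟨t₀⟩ := hT₀.connected.nonempty
  have hD : {k | dbwLE D k}.Nonempty := by
    refine ⟨(Set.univ : Set V).ncard, m₀, G₀, fun t => (β₀ t).val, hT₀, hd₀, ?_, ?_⟩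
    · refine ⟨fun t _ => (β₀ t).2, fun s hs t ht hst => hβ₀.injOn hs ht (Subtype.ext hst), ?_⟩
      intro e he
      obtain ⟨t, ht, hte⟩ := hβ₀.surjOn (Set.mem_univ (⟨e, he⟩ : {e : V × V // D.Adj e.1 e.2}))
      exact ⟨t, ht, by simp [hte]⟩
    · intro a b _
      exact Set.ncard_le_ncard (Set.subset_univ _) (Set.toFinite _)
  obtain ⟨m, G, β, hT, hd, hβ, hw⟩ : dbwLE D (dbw D) := Nat.sInf_mem hD
  let β' : Fin m → {e : V × V // D.Adj e.1 e.2} := fun t =>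
    if ht : D.Adj (β t).1 (β t).2 then ⟨β t, ht⟩ else β₀ t₀
  have hval : ∀ t ∈ leaves G, (β' t).val = β t := by
    intro t ht
    have : D.Adj (β t).1 (β t).2 := hβ.mapsTo ht
    simp [β', this]
  refine Nat.sInf_le ⟨m, G, β', hT, hd, ?_, ?_⟩
  · refine ⟨fun _ _ => Set.mem_univ _, ?_, ?_⟩
    · intro s hs t ht hst
      apply hβ.injOn hs ht
      rw [← hval s hs, ← hval t ht, hst]
    · intro e _
      obtain ⟨t, ht, hte⟩ := hβ.surjOn e.2
      exact ⟨t, ht, Subtype.ext (by rw [hval t ht, hte])⟩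
  · intro a b hab
    have hw' := hw a b hab
    have hmem : ∀ e : {e : V × V // D.Adj e.1 e.2},
        e ∈ β' '' (leaves G ∩ side G a b) ↔ e.val ∈ β '' (leaves G ∩ side G a b) := by
      intro e
      constructor
      · rintro ⟨t, ht, rfl⟩
        exact ⟨t, ht, (hval t ht.1).symm⟩
      · rintro ⟨t, ht, hte⟩
        exact ⟨t, ht, Subtype.ext (by rw [hval t ht.1, hte])⟩
    have c1 := cutrk_le_ncard_aux D (β' '' (leaves G ∩ side G a b))ᶜ
      (β' '' (leaves G ∩ side G a b)) (biSep D (β '' (leaves G ∩ side G a b))) (by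
        intro e he f hf hef
        rw [Set.mem_compl_iff, hmem] at he
        rw [hmem] at hf
        refine Or.inl ⟨e.val.1, f.val.2, e.2, he, ?_, ?_⟩
        · rw [hef]; exact f.2
        · rw [hef]; exact hf)
    have c2 := cutrk_le_ncard_aux D (β' '' (leaves G ∩ side G a b))
      (β' '' (leaves G ∩ side G a b))ᶜ (biSep D (β '' (leaves G ∩ side G a b))) (by
        intro e he f hf hef
        rw [Set.mem_compl_iff, hmem] at hf
        rw [hmem] at he
        refine Or.inr ⟨e.val.1, f.val.2, e.2, fun h => h.2 he, ?_, ?_⟩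
        · rw [hef]; exact f.2
        · rw [hef]; exact ⟨f.2, hf⟩)
    omega
end

section
/- Let D be a digraph without parallel edges and let (E(D)∖X, X) be an edge partition of D. Let λ₁ : E(D)∖X → S and λ₂ : X → S be functions into a set S with |S| = k. If the vertex partition (E(D)∖X, X) of the directed line-graph L⃗(D) is (λ₁, λ₂)-consistent, then the edge partition (E(D)∖X, X) has directed order at most 4k in D, i.e., its directed vertex separator has at most 4k elements. -/
open scoped Classical

/-- Let `D` be a digraph (without parallel edges) and `(E(D)∖X, X)` an
edge partition of `D`. If `λ₁, λ₂` map into a set `S` of cardinality `k` and the vertex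
partition `(E(D)∖X, X)` of `L⃗(D)` is `(λ₁, λ₂)`-consistent, then the directed vertex
separator of `(E(D)∖X, X)` in `D` has at most `4k` elements. -/
theorem dirSep_ncard_le_of_consistent {V : Type} [Fintype V] (D : Digraph V)
    (X : Set (V × V)) (hX : X ⊆ D.edgeSet')
    (S : Type) (hfin : Finite S) (k : ℕ) (hcard : Nat.card S = k)
    (l₁ l₂ : {e : V × V // D.Adj e.1 e.2} → S)
    (hcons : Consistent (dirLineGraph D)
      {e : {e : V × V // D.Adj e.1 e.2} | (e : V × V) ∉ X}
      {e : {e : V × V // D.Adj e.1 e.2} | (e : V × V) ∈ X} l₁ l₂) :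
    (dirSep D X).ncard ≤ 4 * k := by
  have key : ∀ y : dirSep D X, ∃ e : {e : V × V // D.Adj e.1 e.2},
      (e : V × V) ∉ X ∧ e.val.2 = y.val := by
    rintro ⟨y, x, z, hxy, hx, -, -⟩
    exact ⟨⟨(x, y), hxy⟩, hx, rfl⟩
  choose f hf hfy using key
  have hinj : Function.Injective (fun y => l₁ (f y)) := by
    intro y y' h
    obtain ⟨-, z, -, -, hz, hzX⟩ := y.2
    have h1 := (hcons.1 (f y) (hf y) (f y') (hf y') h ⟨(y.val, z), hz⟩ hzX).1 (hfy y)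
    exact Subtype.ext (h1.symm.trans (hfy y'))
  have h2 : (dirSep D X).ncard ≤ Nat.card S := Nat.card_le_card_of_injective _ hinj
  omega
end

section
/- If D is a digraph without parallel edges such that bcrk(L⃗(D)) ≤ k, then dbw(D) ≤ 8·(1 + 2^k). -/
open scoped Classical

lemma ncard_dirSep_le_cutrk {V : Type} [Fintype V] (D : Digraph V)
    (Y : Set {e : V × V // D.Adj e.1 e.2}) :
    (dirSep D (Subtype.val '' Y)).ncard ≤ cutrk (dirLineGraph D) Yᶜ Y := by
  have h1 : ∀ y : dirSep D (Subtype.val '' Y), ∃ e : {e : V × V // D.Adj e.1 e.2},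
      e ∈ Yᶜ ∧ e.val.2 = y.1 := by
    rintro ⟨y, x, z, hxy, hx, hyz, hz⟩
    exact ⟨⟨(x, y), hxy⟩, fun hm => hx ⟨_, hm, rfl⟩, rfl⟩
  have h2 : ∀ y : dirSep D (Subtype.val '' Y), ∃ f : Y, f.val.val.1 = y.1 := by
    rintro ⟨y, x, z, hxy, hx, hyz, f, hf, hfe⟩
    exact ⟨⟨f, hf⟩, by simp [hfe]⟩
  choose e he hey using h1
  choose f hfy using h2
  unfold cutrk
  set P := Submodule.span (ZMod 2)
    ((fun a => fun b : Y => adjFun (dirLineGraph D) a b.1) '' Yᶜ) with hP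
  let r : dirSep D (Subtype.val '' Y) → P := fun y =>
    ⟨fun b : Y => adjFun (dirLineGraph D) (e y) b.1,
      Submodule.subset_span ⟨e y, he y, rfl⟩⟩
  have hli : LinearIndependent (ZMod 2) r := by
    apply LinearIndependent.of_comp ((LinearMap.funLeft (ZMod 2) (ZMod 2) f).comp P.subtype)
    have : (((LinearMap.funLeft (ZMod 2) (ZMod 2) f).comp P.subtype) ∘ r) =
        fun y => Pi.single y (1 : ZMod 2) := by
      funext y z
      simp only [r, Function.comp, LinearMap.comp_apply, Submodule.subtype_apply,
        LinearMap.funLeft_apply, adjFun, dirLineGraph, hey, hfy, Pi.single_apply]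
      simp only [Subtype.ext_iff, eq_comm]
    rw [this]
    exact Pi.linearIndependent_single_one _ _
  have := hli.fintype_card_le_finrank
  rwa [← Nat.card_eq_fintype_card, Nat.card_coe_set_eq] at this

lemma ncard_biSep_le {V : Type} [Fintype V] (D : Digraph V)
    (Y : Set {e : V × V // D.Adj e.1 e.2}) :
    (biSep D (Subtype.val '' Y)).ncard ≤
      cutrk (dirLineGraph D) Yᶜ Y + cutrk (dirLineGraph D) Y Yᶜ := by
  have hc : D.edgeSet' \ (Subtype.val '' Y) = Subtype.val '' Yᶜ := by
    ext p
    constructor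
    · rintro ⟨hp, hn⟩
      exact ⟨⟨p, hp⟩, fun hm => hn ⟨_, hm, rfl⟩, rfl⟩
    · rintro ⟨q, hq, rfl⟩
      refine ⟨q.2, ?_⟩
      rintro ⟨q', hq', h⟩
      exact hq (Subtype.ext h ▸ hq')
  unfold biSep
  rw [hc]
  refine (Set.ncard_union_le _ _).trans (Nat.add_le_add (ncard_dirSep_le_cutrk D Y) ?_)
  simpa using ncard_dirSep_le_cutrk D Yᶜ

lemma dbwLE_of_bcrkLE {V : Type} [Fintype V] (D : Digraph V) (n : ℕ)
    (h : bcrkLE (dirLineGraph D) n) : dbwLE D n := by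
  obtain ⟨m, G, β, hT, hd, hβ, hw⟩ := h
  refine ⟨m, G, fun t => (β t).val, hT, hd, ?_, ?_⟩
  · refine ⟨fun t _ => (β t).2, ?_, ?_⟩
    · intro a ha b hb hab
      exact hβ.injOn ha hb (Subtype.ext hab)
    · intro p hp
      obtain ⟨t, ht, h⟩ := hβ.surjOn (Set.mem_univ (⟨p, hp⟩ : {e : V × V // D.Adj e.1 e.2}))
      exact ⟨t, ht, congrArg Subtype.val h⟩
  · intro a b hab
    have := ncard_biSep_le D (β '' (leaves G ∩ side G a b))
    rw [Set.image_image] at this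
    exact this.trans (hw a b hab)

lemma exists_bcrkLE_of_dbwLE {V : Type} (D : Digraph V)
    (hne : Nonempty {e : V × V // D.Adj e.1 e.2}) (n : ℕ)
    (h : dbwLE D n) : ∃ k, bcrkLE (dirLineGraph D) k := by
  obtain ⟨m, G, β, hT, hd, hβ, -⟩ := h
  obtain ⟨e₀⟩ := hne
  let γ : Fin m → {e : V × V // D.Adj e.1 e.2} :=
    fun t => if h : D.Adj (β t).1 (β t).2 then ⟨β t, h⟩ else e₀
  have hγ : ∀ t ∈ leaves G, (γ t).val = β t := by
    intro t ht
    have : D.Adj (β t).1 (β t).2 := hβ.mapsTo ht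
    simp [γ, this]
  let w : Fin m × Fin m → ℕ := fun p =>
    cutrk (dirLineGraph D) (γ '' (leaves G ∩ side G p.1 p.2))ᶜ (γ '' (leaves G ∩ side G p.1 p.2)) +
        cutrk (dirLineGraph D) (γ '' (leaves G ∩ side G p.1 p.2))
          (γ '' (leaves G ∩ side G p.1 p.2))ᶜ
  refine ⟨∑ p, w p, m, G, γ, hT, hd, ⟨fun _ _ => Set.mem_univ _, ?_, ?_⟩, ?_⟩
  · intro a ha b hb hab
    apply hβ.injOn ha hb
    rw [← hγ a ha, ← hγ b hb, hab]
  · rintro p -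
    obtain ⟨t, ht, h⟩ := hβ.surjOn (show p.val ∈ D.edgeSet' from p.2)
    exact ⟨t, ht, Subtype.ext ((hγ t ht).trans h)⟩
  · intro a b _
    have hs : w (a, b) ≤ ∑ p, w p :=
      Finset.single_le_sum_of_canonicallyOrdered (Finset.mem_univ (a, b))
    exact hs

/-- If `D` is a digraph (without parallel edges) with
`bcrk(L⃗(D)) ≤ k`, then `dbw(D) ≤ 8·(1 + 2^k)`. -/
theorem dbw_le_of_bcrk_dirLineGraph_le {V : Type} [Fintype V] (D : Digraph V) (k : ℕ)
    (h : bcrk (dirLineGraph D) ≤ k) : dbw D ≤ 8 * (1 + 2 ^ k) := by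
  by_cases hne : ∃ n, bcrkLE (dirLineGraph D) n
  · have h1 : bcrkLE (dirLineGraph D) (bcrk (dirLineGraph D)) := Nat.sInf_mem hne
    have h2 : dbw D ≤ bcrk (dirLineGraph D) := Nat.sInf_le (dbwLE_of_bcrkLE D _ h1)
    have h3 : k < 2 ^ k := Nat.lt_two_pow_self
    omega
  · have h0 : dbw D = 0 := by
      by_cases hs : ∃ n, dbwLE D n
      · obtain ⟨n, hn⟩ := hs
        by_cases hE : Nonempty {e : V × V // D.Adj e.1 e.2}
        · exact absurd (exists_bcrkLE_of_dbwLE D hE n hn) hne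
        · obtain ⟨m, G, β, hT, hd, hβ, -⟩ := hn
          refine Nat.le_zero.mp (Nat.sInf_le ⟨m, G, β, hT, hd, hβ, ?_⟩)
          intro a b _
          have : biSep D (β '' (leaves G ∩ side G a b)) = ∅ := by
            ext y
            simp only [Set.mem_empty_iff_false, iff_false]
            rintro (⟨x, z, hxy, -⟩ | ⟨x, z, hxy, -⟩) <;> exact hE ⟨⟨(x, y), hxy⟩⟩
          simp [this]
      · have : {n | dbwLE D n} = ∅ := by
          ext n
          simp only [Set.mem_ofPred_eq, Set.mem_empty_iff_false, iff_false]
          exact fun hn => hs ⟨n, hn⟩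
        simp [dbw, this]
    omega
end

section
/- Let J be a digraph, x a vertex of J, and e an edge of J. (1) If x never appears as an internal vertex of a directed path in J (i.e., x does not have both an in-neighbor and an out-neighbor), then x does not appear in any bidirected separator of any directed branch decomposition of J. (2) If e never appears in a directed path with at least two edges in J, then dbw(J − e) = dbw(J), where J − e is J with the edge e deleted. -/
open scoped Classical

section helpers

/-- `H` is `G` with a pendant vertex `t` attached at `v`. -/
structure IsExt {S T : Type} (ι : S → T) (t : T) (v : S) (H : SimpleGraph T)
    (G : SimpleGraph S) : Prop where
  inj : Function.Injective ι
  cov : ∀ u, u = t ∨ ∃ s, u = ι s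
  nt : ∀ s, ι s ≠ t
  adj : ∀ a b, H.Adj (ι a) (ι b) ↔ G.Adj a b
  adjt : ∀ a, H.Adj t (ι a) ↔ a = v

lemma reach_map {S T : Type} {H : SimpleGraph T} {G : SimpleGraph S} (r : T → S)
    (hr : ∀ a b, H.Adj a b → G.Reachable (r a) (r b)) {a b : T} (h : H.Reachable a b) :
    G.Reachable (r a) (r b) := by
  obtain ⟨w⟩ := h
  induction w with
  | nil => exact SimpleGraph.Reachable.refl _
  | cons h _ ih => exact (hr _ _ h).trans ih

lemma IsExt.retract {S T : Type} {ι : S → T} {t : T} {v : S} {H : SimpleGraph T}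
    {G : SimpleGraph S} (h : IsExt ι t v H G) :
    ∃ r : T → S, (∀ s, r (ι s) = s) ∧ r t = v := by
  refine ⟨fun u => if hu : ∃ s, u = ι s then hu.choose else v, ?_, ?_⟩
  · intro s
    have hu : ∃ s', ι s = ι s' := ⟨s, rfl⟩
    simp only [dif_pos hu]
    exact (h.inj hu.choose_spec).symm
  · apply dif_neg
    rintro ⟨s, hs⟩
    exact h.nt s hs.symm

lemma IsExt.reach_del {S T : Type} {ι : S → T} {t : T} {v : S} {H : SimpleGraph T}
    {G : SimpleGraph S} (h : IsExt ι t v H G) (a b c d : S) :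
    (H.deleteEdges {s(ι a, ι b)}).Reachable (ι c) (ι d) ↔
      (G.deleteEdges {s(a, b)}).Reachable c d := by
  constructor
  · intro hr
    obtain ⟨r, hr1, hr2⟩ := h.retract
    have := reach_map (G := G.deleteEdges {s(a, b)}) r ?_ hr
    · simpa [hr1] using this
    · intro x y hxy
      simp only [SimpleGraph.deleteEdges_adj, Set.mem_singleton_iff] at hxy
      obtain ⟨h1, h2⟩ := hxy
      rcases h.cov x with rfl | ⟨x, rfl⟩ <;> rcases h.cov y with rfl | ⟨y, rfl⟩
      · exact SimpleGraph.Reachable.refl _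
      · rw [(h.adjt y).1 h1, hr1, hr2]
      · rw [(h.adjt x).1 h1.symm, hr1, hr2]
      · rw [hr1, hr1]
        apply SimpleGraph.Adj.reachable
        rw [SimpleGraph.deleteEdges_adj]
        refine ⟨(h.adj _ _).1 h1, fun hh => h2 ?_⟩
        have := congrArg (Sym2.map ι) (Set.mem_singleton_iff.1 hh)
        simpa using this
  · apply reach_map
    intro x y hxy
    rw [SimpleGraph.deleteEdges_adj] at hxy
    apply SimpleGraph.Adj.reachable
    rw [SimpleGraph.deleteEdges_adj]
    refine ⟨(h.adj _ _).2 hxy.1, fun hh => hxy.2 ?_⟩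
    have hh' : Sym2.map ι s(x, y) = Sym2.map ι s(a, b) := by simpa using hh
    exact Sym2.map.injective h.inj hh'

lemma IsExt.mem_side {S T : Type} {ι : S → T} {t : T} {v : S} {H : SimpleGraph T}
    {G : SimpleGraph S} (h : IsExt ι t v H G) (a b s : S) :
    ι s ∈ side H (ι a) (ι b) ↔ s ∈ side G a b :=
  h.reach_del a b b s

lemma IsExt.t_mem_side {S T : Type} {ι : S → T} {t : T} {v : S} {H : SimpleGraph T}
    {G : SimpleGraph S} (h : IsExt ι t v H G) (a b : S) :
    t ∈ side H (ι a) (ι b) ↔ v ∈ side G a b := by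
  rw [← h.mem_side]
  have : (H.deleteEdges {s(ι a, ι b)}).Adj t (ι v) := by
    rw [SimpleGraph.deleteEdges_adj]
    refine ⟨(h.adjt v).2 rfl, fun hh => ?_⟩
    have h1 : t ∈ s(ι a, ι b) := by
      rw [← Set.mem_singleton_iff.1 hh]; simp
    rcases Sym2.mem_iff.1 h1 with h1 | h1
    · exact h.nt _ h1.symm
    · exact h.nt _ h1.symm
  exact ⟨fun h' => h'.trans this.reachable, fun h' => h'.trans this.reachable.symm⟩

lemma not_reach_leaf {T : Type} {H : SimpleGraph T} {t s u : T} (hl : t ∈ leaves H)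
    (hs : H.Adj t s) (hu : (H.deleteEdges {s(t, s)}).Reachable t u) : u = t := by
  obtain ⟨w⟩ := hu
  cases w with
  | nil => rfl
  | cons h _ =>
    rw [SimpleGraph.deleteEdges_adj] at h
    exact absurd (by rw [hl h.1 hs]; rfl) h.2

lemma side_leaf {T : Type} {H : SimpleGraph T} {t s : T} (hl : t ∈ leaves H)
    (hs : H.Adj t s) : side H s t = {t} := by
  ext u
  constructor
  · intro h
    have h' : (H.deleteEdges {s(s, t)}).Reachable t u := h
    rw [Sym2.eq_swap] at h'
    exact not_reach_leaf hl hs h'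
  · rintro rfl
    exact SimpleGraph.Reachable.refl _

lemma side_leaf' {T : Type} {H : SimpleGraph T} (hc : H.Connected) {t s : T}
    (hl : t ∈ leaves H) (hs : H.Adj t s) : side H t s = {t}ᶜ := by
  ext u
  constructor
  · rintro h rfl
    exact hs.ne (not_reach_leaf hl hs (SimpleGraph.Reachable.symm h)).symm
  · intro h
    have hu : u ≠ t := h
    have := reach_map (G := H.deleteEdges {s(t, s)}) (fun x => if x = t then s else x) ?_
      (hc.preconnected s u)
    · simp only [hu, hs.ne.symm, if_false] at this
      exact this
    · intro a b hab
      by_cases ha : a = t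
      · subst ha
        have : b = s := hl hab hs
        subst this
        simp [hs.ne.symm]
      · by_cases hb : b = t
        · subst hb
          have : a = s := hl hab.symm hs
          subst this
          simp [ha]
        · simp only [ha, hb, if_false]
          apply SimpleGraph.Adj.reachable
          rw [SimpleGraph.deleteEdges_adj]
          refine ⟨hab, fun hh => ?_⟩
          have h1 : t ∈ s(a, b) := by
            rw [Set.mem_singleton_iff.1 hh]; simp
          rcases Sym2.mem_iff.1 h1 with h1 | h1
          · exact ha h1.symm
          · exact hb h1.symm

lemma IsExt.t_leaf {S T : Type} {ι : S → T} {t : T} {v : S} {H : SimpleGraph T}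
    {G : SimpleGraph S} (h : IsExt ι t v H G) : H.neighborSet t = {ι v} := by
  ext u
  rcases h.cov u with rfl | ⟨u, rfl⟩
  · simp [(h.nt v).symm]
  · simp [h.adjt, h.inj.eq_iff]

lemma IsExt.t_mem_leaves {S T : Type} {ι : S → T} {t : T} {v : S} {H : SimpleGraph T}
    {G : SimpleGraph S} (h : IsExt ι t v H G) : t ∈ leaves H := by
  change (H.neighborSet t).Subsingleton
  rw [h.t_leaf]
  exact Set.subsingleton_singleton

lemma IsExt.nbr {S T : Type} {ι : S → T} {t : T} {v : S} {H : SimpleGraph T}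
    {G : SimpleGraph S} (h : IsExt ι t v H G) {s : S} (hs : s ≠ v) :
    H.neighborSet (ι s) = ι '' G.neighborSet s := by
  ext u
  rcases h.cov u with rfl | ⟨u, rfl⟩
  · simp [h.nt, SimpleGraph.adj_comm, h.adjt, hs]
  · simp [h.adj, h.inj.eq_iff]

lemma IsExt.nbrv {S T : Type} {ι : S → T} {t : T} {v : S} {H : SimpleGraph T}
    {G : SimpleGraph S} (h : IsExt ι t v H G) :
    H.neighborSet (ι v) = insert t (ι '' G.neighborSet v) := by
  ext u
  rcases h.cov u with rfl | ⟨u, rfl⟩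
  · simp [SimpleGraph.adj_comm, h.adjt]
  · simp [h.adj, h.inj.eq_iff, h.nt]

lemma IsExt.tree_up {S T : Type} {ι : S → T} {t : T} {v : S} {H : SimpleGraph T}
    {G : SimpleGraph S} (h : IsExt ι t v H G) (hG : G.IsTree) : H.IsTree := by
  have key : ∀ u, H.Reachable u (ι v) := by
    intro u
    rcases h.cov u with rfl | ⟨u, rfl⟩
    · exact ((h.adjt v).2 rfl).reachable
    · exact reach_map ι (fun a b hab => ((h.adj a b).2 hab).reachable)
        (hG.connected.preconnected u v)
  refine ⟨(SimpleGraph.connected_iff _).2 ⟨fun a b => (key a).trans (key b).symm, ⟨t⟩⟩, ?_⟩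
  rw [SimpleGraph.isAcyclic_iff_forall_adj_isBridge]
  intro a b hab
  have hGa := SimpleGraph.isAcyclic_iff_forall_adj_isBridge.1 hG.isAcyclic
  rw [SimpleGraph.isBridge_iff]
  rcases h.cov a with rfl | ⟨a, rfl⟩
  · intro hr
    exact hab.ne (not_reach_leaf h.t_mem_leaves hab hr).symm
  · rcases h.cov b with rfl | ⟨b, rfl⟩
    · intro hr
      rw [Sym2.eq_swap] at hr
      exact hab.ne (not_reach_leaf h.t_mem_leaves hab.symm hr.symm)
    · have := hGa ((h.adj a b).1 hab)
      rw [SimpleGraph.isBridge_iff] at this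
      intro hr
      exact this ((h.reach_del a b a b).1 hr)

lemma IsExt.tree_down {S T : Type} {ι : S → T} {t : T} {v : S} {H : SimpleGraph T}
    {G : SimpleGraph S} (h : IsExt ι t v H G) (hH : H.IsTree) : G.IsTree := by
  obtain ⟨r, hr1, hr2⟩ := h.retract
  have hc : G.Connected := by
    refine (SimpleGraph.connected_iff _).2 ⟨fun a b => ?_, ⟨v⟩⟩
    have := reach_map (G := G) r ?_ (hH.connected.preconnected (ι a) (ι b))
    · simpa [hr1] using this
    · intro x y h1
      rcases h.cov x with rfl | ⟨x, rfl⟩ <;> rcases h.cov y with rfl | ⟨y, rfl⟩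
      · exact SimpleGraph.Reachable.refl _
      · rw [(h.adjt y).1 h1, hr1, hr2]
      · rw [(h.adjt x).1 h1.symm, hr1, hr2]
      · rw [hr1, hr1]
        exact ((h.adj _ _).1 h1).reachable
  refine ⟨hc, ?_⟩
  rw [SimpleGraph.isAcyclic_iff_forall_adj_isBridge]
  intro a b hab
  have hHa := SimpleGraph.isAcyclic_iff_forall_adj_isBridge.1 hH.isAcyclic ((h.adj a b).2 hab)
  rw [SimpleGraph.isBridge_iff] at hHa ⊢
  intro hr
  exact hHa ((h.reach_del a b a b).2 hr)


/-- A partial decomposition with labels on a subset `L` of the leaves. -/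
structure PD {E : Type} {m : ℕ} (G : SimpleGraph (Fin m)) (L : Set (Fin m)) (β : Fin m → E)
    (P : Set E → Prop) : Prop where
  tree : G.IsTree
  deg : maxDegLE3 G
  sub : L ⊆ leaves G
  inj : Set.InjOn β L
  cut : ∀ a b, G.Adj a b → P (β '' (L ∩ side G a b))

lemma prune {E : Type} (P : Set E → Prop) : ∀ (m : ℕ) (G : SimpleGraph (Fin m))
    (L : Set (Fin m)) (β : Fin m → E), PD G L β P → L.Nonempty →
    ∃ (m' : ℕ) (G' : SimpleGraph (Fin m')) (β' : Fin m' → E),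
      PD G' (leaves G') β' P ∧ β' '' leaves G' = β '' L := by
  intro m
  induction m with
  | zero =>
    rintro G L β h ⟨x, _⟩
    exact x.elim0
  | succ m ih =>
    intro G L β h hne
    by_cases hL : L = leaves G
    · subst hL
      exact ⟨_, G, β, h, rfl⟩
    obtain ⟨t, ht, htL⟩ : ∃ t ∈ leaves G, t ∉ L := by
      by_contra! hcon
      exact hL (h.sub.antisymm hcon)
    obtain ⟨l, hl⟩ := hne
    have hlt : t ≠ l := fun hh => htL (hh ▸ hl)
    obtain ⟨w⟩ := h.tree.connected.preconnected t l
    obtain ⟨v', hv'⟩ : ∃ v', G.Adj t v' := by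
      cases w with
      | nil => exact absurd rfl hlt
      | cons hh _ => exact ⟨_, hh⟩
    obtain ⟨v, rfl⟩ := Fin.exists_succAbove_eq hv'.ne.symm
    have hE : IsExt t.succAbove t v G (G.comap t.succAbove) :=
      { inj := Fin.succAbove_right_injective
        cov := fun u => by
          by_cases hu : u = t
          · exact Or.inl hu
          · obtain ⟨s, hs⟩ := Fin.exists_succAbove_eq hu
            exact Or.inr ⟨s, hs.symm⟩
        nt := fun s => Fin.succAbove_ne t s
        adj := fun a b => Iff.rfl
        adjt := fun a => ⟨fun hh => Fin.succAbove_right_injective (ht hh hv'),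
          fun hh => hh ▸ hv'⟩ }
    have himg : ∀ Z : Set (Fin (m+1)), t.succAbove '' (t.succAbove ⁻¹' (L ∩ Z)) = L ∩ Z := by
      intro Z
      rw [Set.image_preimage_eq_iff]
      rintro u ⟨hu, _⟩
      rcases hE.cov u with rfl | ⟨s, rfl⟩
      · exact absurd hu htL
      · exact ⟨s, rfl⟩
    have himg' := himg Set.univ
    rw [Set.inter_univ] at himg'
    have hPD : PD (G.comap t.succAbove) (t.succAbove ⁻¹' L) (β ∘ t.succAbove) P :=
      { tree := hE.tree_down h.tree
        deg := fun s => by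
          refine le_trans ?_ (h.deg (t.succAbove s))
          rw [← Set.ncard_image_of_injective _ hE.inj]
          apply Set.ncard_le_ncard _ (Set.toFinite _)
          rintro _ ⟨y, hy, rfl⟩
          exact hy
        sub := fun s hs a ha b hb => hE.inj (h.sub hs ha hb)
        inj := fun a ha b hb hab => hE.inj (h.inj ha hb hab)
        cut := fun a b hab => by
          have := h.cut _ _ ((hE.adj a b).2 hab)
          rw [← himg, Set.image_image] at this
          have hset : t.succAbove ⁻¹' (L ∩ side G (t.succAbove a) (t.succAbove b)) =
              t.succAbove ⁻¹' L ∩ side (G.comap t.succAbove) a b := by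
            ext s
            exact and_congr Iff.rfl (hE.mem_side a b s)
          rw [hset] at this
          exact this }
    obtain ⟨m', G', β', h1, h2⟩ := ih _ _ _ hPD (by
      obtain ⟨s, rfl⟩ := Fin.exists_succAbove_eq hlt.symm
      exact ⟨s, hl⟩)
    refine ⟨m', G', β', h1, ?_⟩
    rw [h2, Set.image_comp, himg']

lemma exists_ext {m : ℕ} (G : SimpleGraph (Fin m)) (v : Fin m) :
    ∃ H : SimpleGraph (Fin (m+1)), IsExt Fin.castSucc (Fin.last m) v H G := by
  refine ⟨G.map Fin.castSuccEmb ⊔ SimpleGraph.edge (Fin.last m) v.castSucc, ?_⟩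
  refine ⟨Fin.castSucc_injective m, fun u => ?_, fun s => (Fin.castSucc_lt_last s).ne,
    fun a b => ?_, fun a => ?_⟩
  · induction u using Fin.lastCases with
    | last => exact Or.inl rfl
    | cast i => exact Or.inr ⟨i, rfl⟩
  · have ha := (Fin.castSucc_lt_last a).ne
    have hb := (Fin.castSucc_lt_last b).ne
    have hm := SimpleGraph.map_adj_apply (G := G) (f := Fin.castSuccEmb) (a := a) (b := b)
    simpa [SimpleGraph.edge_adj, ha, hb] using hm
  · have ha := (Fin.castSucc_lt_last a).ne
    have hv := (Fin.castSucc_lt_last v).ne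
    have hm : ¬ (G.map Fin.castSucc).Adj (Fin.last m) a.castSucc := by
      rw [SimpleGraph.map_adj']
      rintro ⟨-, x, y, -, hx, -⟩
      exact (Fin.castSucc_lt_last x).ne hx
    simp [SimpleGraph.edge_adj, ha.symm, hv.symm, hm]

lemma add_leaf {E : Type} (P : Set E → Prop) {m : ℕ} (G : SimpleGraph (Fin m))
    (L : Set (Fin m)) (β : Fin m → E) (c : E) (t : Fin m)
    (tree : G.IsTree) (deg : maxDegLE3 G) (sub : L ⊆ leaves G) (inj : Set.InjOn β L)
    (ht : (G.neighborSet t).ncard ≤ 2) (hc : c ∉ β '' (L \ {t}))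
    (cut : ∀ a b, G.Adj a b → P (β '' ((L \ {t}) ∩ side G a b) ∪ {e | e = c ∧ t ∈ side G a b}))
    (cut1 : P {c}) (cut2 : P (β '' (L \ {t}))) :
    ∃ (H : SimpleGraph (Fin (m+1))) (L' : Set (Fin (m+1))) (β' : Fin (m+1) → E),
      PD H L' β' P ∧ β' '' L' = insert c (β '' (L \ {t})) ∧
      ∃ t', t' ∉ L' ∧ (H.neighborSet t').ncard ≤ (G.neighborSet t).ncard + 1 := by
  obtain ⟨H, hE⟩ := exists_ext G t
  let β' : Fin (m+1) → E := fun u => Fin.lastCases (motive := fun _ => E) c β u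
  have hβl : β' (Fin.last m) = c := by simp [β']
  have hβc : ∀ s, β' (Fin.castSucc s) = β s := by intro s; simp [β']
  have hdt : (H.neighborSet t.castSucc).ncard ≤ (G.neighborSet t).ncard + 1 := by
    rw [hE.nbrv]
    refine (Set.ncard_insert_le _ _).trans ?_
    rw [Set.ncard_image_of_injective _ hE.inj]
  have htree := hE.tree_up tree
  refine ⟨H, insert (Fin.last m) (Fin.castSucc '' (L \ {t})), β', ⟨htree, ?_, ?_, ?_, ?_⟩, ?_,
    t.castSucc, ?_, hdt⟩
  · intro u
    rcases hE.cov u with rfl | ⟨s, rfl⟩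
    · rw [hE.t_leaf]; simp
    · by_cases hs : s = t
      · subst hs; omega
      · rw [hE.nbr hs, Set.ncard_image_of_injective _ hE.inj]
        exact deg s
  · rintro u (rfl | ⟨s, ⟨hs, hst⟩, rfl⟩)
    · exact hE.t_mem_leaves
    · change (H.neighborSet _).Subsingleton
      rw [hE.nbr hst]
      exact (sub hs).image _
  · rintro u (rfl | ⟨s, ⟨hs, hst⟩, rfl⟩) w (rfl | ⟨r, ⟨hr, hrt⟩, rfl⟩) huw
    · rfl
    · rw [hβl, hβc] at huw
      exact absurd ⟨r, ⟨hr, hrt⟩, huw.symm⟩ hc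
    · rw [hβl, hβc] at huw
      exact absurd ⟨s, ⟨hs, hst⟩, huw⟩ hc
    · rw [hβc, hβc] at huw
      rw [inj hs hr huw]
  · intro a b hab
    rcases hE.cov a with rfl | ⟨a, rfl⟩
    · rw [side_leaf' htree.connected hE.t_mem_leaves hab]
      convert cut2 using 1
      ext e
      constructor
      · rintro ⟨u, ⟨rfl | ⟨s, hs, rfl⟩, hu⟩, rfl⟩
        · exact absurd rfl hu
        · exact ⟨s, hs, (hβc s).symm⟩
      · rintro ⟨s, hs, rfl⟩
        exact ⟨s.castSucc, ⟨Or.inr ⟨s, hs, rfl⟩, hE.nt s⟩, hβc s⟩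
    · rcases hE.cov b with rfl | ⟨b, rfl⟩
      · rw [side_leaf hE.t_mem_leaves hab.symm]
        convert cut1 using 1
        ext e
        constructor
        · rintro ⟨u, ⟨_, rfl⟩, rfl⟩
          exact hβl
        · rintro rfl
          exact ⟨_, ⟨Or.inl rfl, rfl⟩, hβl⟩
      · convert cut a b ((hE.adj a b).1 hab) using 1
        ext e
        constructor
        · rintro ⟨u, ⟨rfl | ⟨s, hs, rfl⟩, hu⟩, rfl⟩
          · exact Or.inr ⟨hβl, (hE.t_mem_side a b).1 hu⟩
          · exact Or.inl ⟨s, ⟨hs, (hE.mem_side a b s).1 hu⟩, (hβc s).symm⟩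
        · rintro (⟨s, ⟨hs, hu⟩, rfl⟩ | ⟨rfl, hu⟩)
          · exact ⟨s.castSucc, ⟨Or.inr ⟨s, hs, rfl⟩, (hE.mem_side a b s).2 hu⟩, hβc s⟩
          · exact ⟨_, ⟨Or.inl rfl, (hE.t_mem_side a b).2 hu⟩, hβl⟩
  · rw [Set.image_insert_eq, hβl, Set.image_image]
    simp only [hβc]
  · rintro (h | ⟨s, ⟨_, hs⟩, h⟩)
    · exact hE.nt _ h
    · exact hs (hE.inj h)

/-! ### Separators -/

lemma dirSep_delete {V : Type} {J : Digraph V} {p q : V}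
    (h1 : ¬∃ w, J.Adj w p) (h2 : ¬∃ z, J.Adj q z) {X Y : Set (V × V)}
    (hXY : ∀ f, f ≠ (p, q) → (f ∈ X ↔ f ∈ Y)) :
    dirSep (J.deleteEdge p q) X = dirSep J Y := by
  ext y
  constructor
  · rintro ⟨x, z, ⟨ha, ha'⟩, hx, ⟨hb, hb'⟩, hz⟩
    exact ⟨x, z, ha, fun h => hx ((hXY _ (by simpa using ha')).2 h), hb,
      (hXY _ (by simpa using hb')).1 hz⟩
  · rintro ⟨x, z, ha, hx, hb, hz⟩
    have ha' : ¬(x = p ∧ y = q) := by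
      rintro ⟨rfl, rfl⟩; exact h2 ⟨_, hb⟩
    have hb' : ¬(y = p ∧ z = q) := by
      rintro ⟨rfl, rfl⟩; exact h1 ⟨_, ha⟩
    exact ⟨x, z, ⟨ha, ha'⟩, fun h => hx ((hXY _ (by simpa using ha')).1 h), ⟨hb, hb'⟩,
      (hXY _ (by simpa using hb')).2 hz⟩

lemma biSep_delete {V : Type} {J : Digraph V} {p q : V}
    (h1 : ¬∃ w, J.Adj w p) (h2 : ¬∃ z, J.Adj q z) {X Y : Set (V × V)}
    (hXY : ∀ f, f ≠ (p, q) → (f ∈ X ↔ f ∈ Y)) :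
    biSep (J.deleteEdge p q) X = biSep J Y := by
  unfold biSep
  rw [dirSep_delete h1 h2 hXY, dirSep_delete h1 h2 (Y := J.edgeSet' \ Y)]
  rintro ⟨a, b⟩ hf
  have : ¬(a = p ∧ b = q) := by simpa using hf
  have h3 : (a, b) ∈ (J.deleteEdge p q).edgeSet' ↔ (a, b) ∈ J.edgeSet' :=
    ⟨fun h => h.1, fun h => ⟨h, this⟩⟩
  exact and_congr h3 (not_congr (hXY _ hf))

lemma biSep_empty {V : Type} (D : Digraph V) : biSep D ∅ = ∅ := by
  ext y
  simp only [biSep, dirSep, Digraph.edgeSet', Set.mem_union, Set.mem_ofPred_eq, Set.mem_sdiff,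
    Set.mem_empty_iff_false, iff_false]
  rintro (⟨x, z, _, _, _, h⟩ | ⟨x, z, h, h', _⟩)
  · exact h
  · exact h' ⟨h, id⟩

lemma biSep_full {V : Type} (D : Digraph V) : biSep D D.edgeSet' = ∅ := by
  ext y
  simp only [biSep, dirSep, Digraph.edgeSet', Set.mem_union, Set.mem_ofPred_eq, Set.mem_sdiff,
    Set.mem_empty_iff_false, iff_false]
  rintro (⟨x, z, h, h', _⟩ | ⟨x, z, _, _, h, h', h''⟩)
  · exact h' h
  · exact h'' h

lemma edgeSet_delete {V : Type} (J : Digraph V) (p q : V) :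
    (J.deleteEdge p q).edgeSet' = J.edgeSet' \ {(p, q)} := by
  ext ⟨a, b⟩
  simp [Digraph.edgeSet', Digraph.deleteEdge]

lemma dbwLE_down {V : Type} {J : Digraph V} {p q : V}
    (h1 : ¬∃ w, J.Adj w p) (h2 : ¬∃ z, J.Adj q z)
    (hne : (J.deleteEdge p q).edgeSet'.Nonempty) {k : ℕ} (h : dbwLE J k) :
    dbwLE (J.deleteEdge p q) k := by
  obtain ⟨m, G, β, ht, hd, hb, hk⟩ := h
  have himg : β '' {l ∈ leaves G | β l ≠ (p, q)} = (J.deleteEdge p q).edgeSet' := by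
    rw [edgeSet_delete, ← hb.image_eq]
    ext f
    constructor
    · rintro ⟨l, ⟨hl, hl'⟩, rfl⟩
      exact ⟨⟨l, hl, rfl⟩, hl'⟩
    · rintro ⟨⟨l, hl, rfl⟩, hl'⟩
      exact ⟨l, ⟨hl, hl'⟩, rfl⟩
  have hPD : PD G {l ∈ leaves G | β l ≠ (p, q)} β
      (fun X => (biSep (J.deleteEdge p q) X).ncard ≤ k) :=
    { tree := ht
      deg := hd
      sub := fun l hl => hl.1
      inj := hb.injOn.mono fun l hl => hl.1
      cut := fun a b hab => by
        rw [biSep_delete h1 h2 (Y := β '' (leaves G ∩ side G a b))]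
        · exact hk a b hab
        · intro f hf
          constructor
          · rintro ⟨l, ⟨hl, hs⟩, rfl⟩
            exact ⟨l, ⟨hl.1, hs⟩, rfl⟩
          · rintro ⟨l, ⟨hl, hs⟩, rfl⟩
            exact ⟨l, ⟨⟨hl, hf⟩, hs⟩, rfl⟩ }
  obtain ⟨m', G', β', h3, h4⟩ := prune _ _ _ _ _ hPD (by
    rw [← himg] at hne
    exact hne.of_image)
  refine ⟨m', G', β', h3.tree, h3.deg, ?_, h3.cut⟩
  rw [← himg, ← h4]
  exact h3.inj.bijOn_image

lemma exists_leaf {m : ℕ} {G : SimpleGraph (Fin m)} (h : G.IsTree) : (leaves G).Nonempty := by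
  have := h.connected.nonempty
  rcases subsingleton_or_nontrivial (Fin m) with hs | hs
  · exact ⟨this.some, fun a _ b _ => Subsingleton.elim _ _⟩
  · obtain ⟨v, hv⟩ := h.exists_vert_degree_one_of_nontrivial
    refine ⟨v, fun a ha b hb => ?_⟩
    obtain ⟨w, _, hw⟩ := SimpleGraph.degree_eq_one_iff_existsUnique_adj.1 hv
    rw [hw a ha, hw b hb]

lemma dbwLE_up {V : Type} {J : Digraph V} {p q : V} (he : J.Adj p q)
    (h1 : ¬∃ w, J.Adj w p) (h2 : ¬∃ z, J.Adj q z) {k : ℕ}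
    (h : dbwLE (J.deleteEdge p q) k) : dbwLE J k := by
  obtain ⟨m, G, β, ht, hd, hb, hk⟩ := h
  have hins : ∀ X, biSep J (insert (p, q) X) = biSep J X := by
    intro X
    rw [← biSep_delete h1 h2 (X := X) (Y := X) (fun _ _ => Iff.rfl)]
    refine (biSep_delete h1 h2 ?_).symm
    intro f hf
    simp [hf]
  have hdel : ∀ X, biSep (J.deleteEdge p q) X = biSep J X :=
    fun X => biSep_delete h1 h2 (fun _ _ => Iff.rfl)
  have hfull : biSep J (J.deleteEdge p q).edgeSet' = ∅ := by
    rw [← hdel, biSep_full]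
  simp only [hdel] at hk
  obtain ⟨t, hl⟩ := exists_leaf ht
  have hn1 : (G.neighborSet t).ncard ≤ 1 :=
    Set.ncard_le_one_iff_subsingleton.2 hl
  have hbt : β '' (leaves G \ {t}) = (J.deleteEdge p q).edgeSet' \ {β t} := by
    rw [← hb.image_eq]
    ext f
    constructor
    · rintro ⟨l, ⟨hl1, hl2⟩, rfl⟩
      exact ⟨⟨l, hl1, rfl⟩, fun hh => hl2 (hb.injOn hl1 hl hh)⟩
    · rintro ⟨⟨l, hl1, rfl⟩, hl2⟩
      exact ⟨l, ⟨hl1, fun hh => hl2 (by rw [hh]; rfl)⟩, rfl⟩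
  have hbtm : β t ∈ (J.deleteEdge p q).edgeSet' := hb.mapsTo hl
  have hc12 : (biSep J {β t}).ncard ≤ k ∧ (biSep J (β '' (leaves G \ {t}))).ncard ≤ k := by
    by_cases hs : ∃ s, G.Adj t s
    · obtain ⟨s, hs⟩ := hs
      have e1 := hk s t hs.symm
      have e2 := hk t s hs
      rw [side_leaf hl hs] at e1
      rw [side_leaf' ht.connected hl hs] at e2
      have : leaves G ∩ {t} = {t} := by
        simpa using hl
      rw [this, Set.image_singleton] at e1
      exact ⟨e1, e2⟩
    · have hall : ∀ u, u = t := by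
        intro u
        obtain ⟨w⟩ := ht.connected.preconnected t u
        cases w with
        | nil => rfl
        | cons hh _ => exact absurd ⟨_, hh⟩ hs
      have e1 : leaves G = {t} := by
        ext u; simp [hall u, hl]
      have e2 : (J.deleteEdge p q).edgeSet' = {β t} := by
        rw [← hb.image_eq, e1, Set.image_singleton]
      rw [← e2, hfull, hbt, e2, Set.sdiff_self, biSep_empty]
      simp
  obtain ⟨H, L', β', hP, himg, t', ht', hdeg⟩ :=
    add_leaf (fun X => (biSep J X).ncard ≤ k) G (leaves G) β (β t) t ht hd subset_rfl hb.injOn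
      (by omega) (by rw [hbt]; simp)
      (fun a b hab => by
        convert hk a b hab using 3
        ext f
        constructor
        · rintro (⟨l, ⟨⟨hl1, _⟩, hl2⟩, rfl⟩ | ⟨rfl, hl2⟩)
          · exact ⟨l, ⟨hl1, hl2⟩, rfl⟩
          · exact ⟨t, ⟨hl, hl2⟩, rfl⟩
        · rintro ⟨l, ⟨hl1, hl2⟩, rfl⟩
          by_cases hlt : l = t
          · subst hlt
            exact Or.inr ⟨rfl, hl2⟩
          · exact Or.inl ⟨l, ⟨⟨hl1, hlt⟩, hl2⟩, rfl⟩)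
      hc12.1 hc12.2
  have himg2 : β' '' L' = (J.deleteEdge p q).edgeSet' := by
    rw [himg, hbt, Set.insert_sdiff_singleton, Set.insert_eq_of_mem hbtm]
  have hL' : L' \ {t'} = L' := Set.sdiff_singleton_eq_self ht'
  obtain ⟨H2, L2, β2, hP2, himg3, -⟩ :=
    add_leaf (fun X => (biSep J X).ncard ≤ k) H L' β' (p, q) t' hP.tree hP.deg hP.sub hP.inj
      (by omega) (by rw [hL', himg2, edgeSet_delete]; simp)
      (fun a b hab => by
        have := hP.cut a b hab
        rw [hL']
        by_cases hm : t' ∈ side H a b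
        · simpa [hm, hins] using this
        · simpa [hm] using this)
      (by
        have := hins ∅
        rw [biSep_empty] at this
        simp only [insert_empty_eq] at this
        simp [this])
      (by
        rw [hL', himg2, hfull]
        simp)
  have hne : L2.Nonempty := by
    have : (β2 '' L2).Nonempty := by
      rw [himg3]; exact Set.insert_nonempty _ _
    exact this.of_image
  obtain ⟨m', G', βf, h3, h4⟩ := prune _ _ _ _ _ hP2 hne
  refine ⟨m', G', βf, h3.tree, h3.deg, ?_, h3.cut⟩
  have : J.edgeSet' = βf '' leaves G' := by
    rw [h4, himg3, hL', himg2, edgeSet_delete, Set.insert_sdiff_singleton,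
      Set.insert_eq_of_mem]
    exact he
  rw [this]
  exact h3.inj.bijOn_image

end helpers

/-- (1) If `x` never appears as an internal vertex of a directed path in `J`
(i.e. `x` does not have both an in-neighbour and an out-neighbour) then `x` does not appear
in any bidirected separator of any directed branch decomposition of `J`.
(2) If the edge `p→q` never appears in a directed path with at least two edges in `J`
(no edge enters `p` and no edge leaves `q`), then `dbw(J − e) = dbw(J)`. -/
theorem isolated_elements {V : Type} [Fintype V] (J : Digraph V) (x p q : V)
    (he : J.Adj p q) :
    (¬((∃ w, J.Adj w x) ∧ (∃ z, J.Adj x z)) →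
      ∀ (m : ℕ) (G : SimpleGraph (Fin m)) (β : Fin m → V × V),
        G.IsTree → maxDegLE3 G → Set.BijOn β (leaves G) J.edgeSet' →
        ∀ a b : Fin m, G.Adj a b → x ∉ biSep J (β '' (leaves G ∩ side G a b))) ∧
    ((¬∃ w, J.Adj w p) ∧ (¬∃ z, J.Adj q z) → dbw (J.deleteEdge p q) = dbw J) := by
  constructor
  · rintro hx m G β - - - a b - (⟨w, z, hw, -, hz, -⟩ | ⟨w, z, hw, -, hz, -⟩)
    · exact hx ⟨⟨w, hw⟩, ⟨z, hz⟩⟩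
    · exact hx ⟨⟨w, hw⟩, ⟨z, hz⟩⟩
  · rintro ⟨h1, h2⟩
    by_cases hne : (J.deleteEdge p q).edgeSet'.Nonempty
    · unfold dbw
      congr 1
      ext k
      exact ⟨dbwLE_up he h1 h2, dbwLE_down h1 h2 hne⟩
    · have hempty : ∀ a b, ¬ (J.deleteEdge p q).Adj a b :=
        fun a b hab => hne ⟨(a, b), hab⟩
      have hb : ∀ X, biSep (J.deleteEdge p q) X = ∅ := by
        intro X
        ext y
        simp [biSep, dirSep, hempty]
      have hbJ : ∀ X, biSep J X = ∅ := by
        intro X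
        rw [← biSep_delete h1 h2 (X := X) (Y := X) (fun _ _ => Iff.rfl), hb]
      have key : ∀ D : Digraph V, (∀ X, biSep D X = ∅) → dbw D = 0 := by
        intro D hD
        unfold dbw
        rw [Nat.sInf_eq_zero]
        by_cases hk : {k | dbwLE D k} = ∅
        · exact Or.inr hk
        · left
          obtain ⟨k, m, G, β, a1, a2, a3, a4⟩ := Set.nonempty_iff_ne_empty.2 hk
          exact ⟨m, G, β, a1, a2, a3, fun a b _ => by simp [hD]⟩
      rw [key _ hb, key _ hbJ]
end

section
/- There does not exist any function f : ℕ → ℕ such that for every digraph D, bw(u(D)) ≤ f(dbw(D)), where u(D) is the underlying undirected graph of D. Equivalently, there is a sequence of digraphs of directed branch-width 0 whose underlying undirected branch-widths are unbounded. -/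
open scoped Classical

/-! ### Sides of tree edges -/

lemma not_mem_side_self {T : Type} {G : SimpleGraph T} (hG : G.IsTree) {a b : T}
    (h : G.Adj a b) : a ∉ side G a b := by
  intro hm
  have hb := SimpleGraph.isAcyclic_iff_forall_isBridge.1 hG.isAcyclic
    (e := s(a, b)) ((SimpleGraph.mem_edgeSet G).2 h)
  rw [SimpleGraph.isBridge_iff] at hb
  exact hb (SimpleGraph.Reachable.symm hm)

lemma self_mem_side {T : Type} (G : SimpleGraph T) (a b : T) : b ∈ side G a b :=
  SimpleGraph.Reachable.refl b

lemma mem_side_step {T : Type} {G : SimpleGraph T} {a b t u : T} (ht : t ∈ side G a b)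
    (h : G.Adj t u) (hne : s(t, u) ≠ s(a, b)) : u ∈ side G a b := by
  refine SimpleGraph.Reachable.trans ht (SimpleGraph.Adj.reachable ?_)
  rw [SimpleGraph.deleteEdges_adj]
  exact ⟨h, by simpa using hne⟩

lemma side_induction {T : Type} {G : SimpleGraph T} {a b : T} {P : T → Prop} (hb : P b)
    (hs : ∀ t u, t ∈ side G a b → P t → G.Adj t u → s(t, u) ≠ s(a, b) → P u) :
    ∀ t ∈ side G a b, P t := by
  intro t ht
  have ht' := (SimpleGraph.reachable_iff_reflTransGen _ _).1 ht
  clear ht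
  induction ht' with
  | refl => exact hb
  | tail h1 h2 ih =>
    rw [SimpleGraph.deleteEdges_adj] at h2
    exact hs _ _ ((SimpleGraph.reachable_iff_reflTransGen _ _).2 h1) ih h2.1 (by simpa using h2.2)

lemma side_ssubset {T : Type} {G : SimpleGraph T} (hG : G.IsTree) {a b c : T}
    (hab : G.Adj a b) (hbc : G.Adj b c) (hca : c ≠ a) : side G b c ⊂ side G a b := by
  have hnb := not_mem_side_self hG hbc
  refine ⟨?_, fun h => hnb (h (self_mem_side G a b))⟩
  refine side_induction ?_ ?_
  · refine mem_side_step (self_mem_side G a b) hbc ?_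
    intro h
    rcases Sym2.eq_iff.1 h with ⟨h1, h2⟩ | ⟨h1, h2⟩
    · exact hab.ne h1.symm
    · exact hca h2
  · intro t u ht hP htu hne
    refine mem_side_step hP htu ?_
    intro h
    rcases Sym2.eq_iff.1 h with ⟨h1, h2⟩ | ⟨h1, h2⟩
    · subst h2
      exact hnb (mem_side_step ht htu hne)
    · subst h1
      exact hnb ht

lemma side_disjoint {T : Type} {G : SimpleGraph T} (hG : G.IsTree) {a b : T}
    (hab : G.Adj a b) : ∀ t, t ∈ side G a b → t ∉ side G b a := by
  intro t h1 h2
  apply not_mem_side_self hG hab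
  have h2' : (G.deleteEdges {s(a, b)}).Reachable a t := by
    have := h2
    unfold side at this
    rwa [Sym2.eq_swap] at this
  exact SimpleGraph.Reachable.trans h1 h2'.symm

lemma cover_sides {T : Type} {G : SimpleGraph T} (hG : G.IsTree) (t u : T) :
    u = t ∨ ∃ s, G.Adj t s ∧ u ∈ side G t s := by
  have h := (SimpleGraph.reachable_iff_reflTransGen _ _).1 (hG.connected.preconnected t u)
  induction h with
  | refl => exact Or.inl rfl
  | @tail v w h1 h2 ih =>
    rcases ih with rfl | ⟨s, hs, hv⟩
    · exact Or.inr ⟨w, h2, self_mem_side G _ _⟩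
    · by_cases he : s(v, w) = s(t, s)
      · rcases Sym2.eq_iff.1 he with ⟨_, h4⟩ | ⟨_, h4⟩
        · subst h4
          exact Or.inr ⟨w, hs, self_mem_side G _ _⟩
        · exact Or.inl h4
      · exact Or.inr ⟨s, hs, mem_side_step hv h2 he⟩

/-- A sink of the orientation of tree edges toward big sides. -/
lemma exists_sink {m : ℕ} {G : SimpleGraph (Fin m)} (hG : G.IsTree)
    (big : Fin m → Fin m → Prop)
    (h : ∀ a b, G.Adj a b → ¬ (big a b ∧ big b a)) :
    ∃ t, ∀ s, G.Adj t s → ¬ big t s := by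
  by_contra hcon
  push Not at hcon
  choose f hf hb using hcon
  haveI : Nonempty (Fin m) := hG.connected.nonempty
  obtain ⟨t, ht⟩ := Finite.exists_min (fun t => (side G t (f t)).ncard)
  by_cases hft : f (f t) = t
  · apply h t (f t) (hf t)
    refine ⟨hb t, ?_⟩
    have := hb (f t)
    rwa [hft] at this
  · have h1 := Set.ncard_lt_ncard (side_ssubset hG (hf t) (hf (f t)) hft) (Set.toFinite _)
    have h2 := ht (f t)
    omega

/-! ### The oriented complete bipartite graph -/

def orK (n : ℕ) : Digraph (Fin n ⊕ Fin n) where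
  Adj a b := ∃ i j, a = Sum.inl i ∧ b = Sum.inr j

lemma orK_edgeSet (n : ℕ) : (underlying (orK n)).edgeSet =
    Set.range (fun p : Fin n × Fin n => s((Sum.inl p.1 : Fin n ⊕ Fin n), Sum.inr p.2)) := by
  ext e
  induction e using Sym2.ind with
  | _ x y =>
    simp only [SimpleGraph.mem_edgeSet, underlying, SimpleGraph.fromRel_adj, orK, Set.mem_range,
      Prod.exists]
    constructor
    · rintro ⟨_, ⟨i, j, rfl, rfl⟩ | ⟨i, j, rfl, rfl⟩⟩
      · exact ⟨i, j, rfl⟩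
      · exact ⟨i, j, Sym2.eq_swap⟩
    · rintro ⟨i, j, h⟩
      rcases Sym2.eq_iff.1 h with ⟨rfl, rfl⟩ | ⟨rfl, rfl⟩
      · exact ⟨by simp, Or.inl ⟨i, j, rfl, rfl⟩⟩
      · exact ⟨by simp, Or.inr ⟨i, j, rfl, rfl⟩⟩

lemma orK_ncard (n : ℕ) : (underlying (orK n)).edgeSet.ncard = n * n := by
  rw [orK_edgeSet, ← Set.image_univ, Set.ncard_image_of_injective, Set.ncard_univ]
  · simp
  · rintro ⟨a, b⟩ ⟨c, d⟩ h
    simpa using h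

lemma orK_dbw (n : ℕ) : dbw (orK n) = 0 := by
  have hs : ∀ X, dirSep (orK n) X = ∅ := by
    intro X
    ext y
    simp only [dirSep, orK, Set.mem_setOf_eq, Set.mem_empty_iff_false, iff_false]
    rintro ⟨x, z, ⟨i, j, _, rfl⟩, _, ⟨i', j', h, _⟩, _⟩
    simp at h
  unfold dbw
  rw [Nat.sInf_eq_zero]
  rcases Set.eq_empty_or_nonempty {k | dbwLE (orK n) k} with h | ⟨k, m, G, β, h1, h2, h3, _⟩
  · exact Or.inr h
  · left
    refine ⟨m, G, β, h1, h2, h3, ?_⟩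
    intro a b _
    simp [biSep, hs]

lemma ncard_pairs {V : Type} [Finite V] {S : Set V} {k : ℕ} (hS : S.ncard ≤ k)
    {Y : Set (Sym2 V)} (hY : ∀ e ∈ Y, ∃ a ∈ S, ∃ b ∈ S, e = s(a, b)) : Y.ncard ≤ k * k := by
  have h1 : Y ⊆ (fun p : V × V => s(p.1, p.2)) '' (S ×ˢ S) := by
    intro e he
    obtain ⟨a, ha, b, hb, rfl⟩ := hY e he
    exact ⟨(a, b), ⟨ha, hb⟩, rfl⟩
  calc Y.ncard ≤ _ := Set.ncard_le_ncard h1 (Set.toFinite _)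
    _ ≤ (S ×ˢ S).ncard := Set.ncard_image_le (Set.toFinite _)
    _ = S.ncard * S.ncard := Set.ncard_prod
    _ ≤ k * k := Nat.mul_le_mul hS hS

lemma orK_sep {n k : ℕ} (hk : k < n) (X : Set (Sym2 (Fin n ⊕ Fin n)))
    (hX : X ⊆ (underlying (orK n)).edgeSet)
    (hS : (usep (underlying (orK n)) X).ncard ≤ k) :
    X.ncard ≤ k * k ∨ ((underlying (orK n)).edgeSet \ X).ncard ≤ k * k := by
  set S := usep (underlying (orK n)) X with hSdef
  have key : ∀ g : Fin n → Fin n ⊕ Fin n, Function.Injective g → ∃ i, g i ∉ S := by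
    intro g hg
    by_contra hcon
    push Not at hcon
    have h1 : (Set.range g).ncard ≤ S.ncard :=
      Set.ncard_le_ncard (by rintro _ ⟨i, rfl⟩; exact hcon i) (Set.toFinite _)
    rw [← Set.image_univ, Set.ncard_image_of_injective _ hg, Set.ncard_univ] at h1
    simp at h1
    omega
  obtain ⟨i, hi⟩ := key Sum.inl Sum.inl_injective
  obtain ⟨j, hj⟩ := key Sum.inr Sum.inr_injective
  have hE : ∀ a b : Fin n, s((Sum.inl a : Fin n ⊕ Fin n), Sum.inr b) ∈
      (underlying (orK n)).edgeSet := by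
    intro a b
    rw [orK_edgeSet]
    exact ⟨(a, b), rfl⟩
  have hmem : ∀ (v : Fin n ⊕ Fin n) e e', e ∈ (underlying (orK n)).edgeSet → e ∉ X → e' ∈ X →
      v ∈ e → v ∈ e' → v ∈ S := fun v e e' h1 h2 h3 h4 h5 => ⟨⟨e, ⟨h1, h2⟩, h4⟩, ⟨e', h3, h5⟩⟩
  by_cases hij : s((Sum.inl i : Fin n ⊕ Fin n), Sum.inr j) ∈ X
  · right
    refine ncard_pairs hS ?_
    rintro e ⟨he, heX⟩
    have he' := he
    rw [orK_edgeSet] at he'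
    obtain ⟨⟨a, b⟩, rfl⟩ := he'
    refine ⟨_, ?_, _, ?_, rfl⟩
    · have : s((Sum.inl a : Fin n ⊕ Fin n), Sum.inr j) ∈ X := by
        by_contra h
        exact hj (hmem _ _ _ (hE a j) h hij (by simp) (by simp))
      exact hmem _ _ _ he heX this (by simp) (by simp)
    · have : s((Sum.inl i : Fin n ⊕ Fin n), Sum.inr b) ∈ X := by
        by_contra h
        exact hi (hmem _ _ _ (hE i b) h hij (by simp) (by simp))
      exact hmem _ _ _ he heX this (by simp) (by simp)
  · left
    refine ncard_pairs hS ?_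
    intro e heX
    have he' := hX heX
    rw [orK_edgeSet] at he'
    obtain ⟨⟨a, b⟩, rfl⟩ := he'
    refine ⟨_, ?_, _, ?_, rfl⟩
    · have : s((Sum.inl a : Fin n ⊕ Fin n), Sum.inr j) ∉ X := by
        intro h
        exact hj (hmem _ _ _ (hE i j) hij h (by simp) (by simp))
      exact hmem _ _ _ (hE a j) this heX (by simp) (by simp)
    · have : s((Sum.inl i : Fin n ⊕ Fin n), Sum.inr b) ∉ X := by
        intro h
        exact hi (hmem _ _ _ (hE i j) hij h (by simp) (by simp))
      exact hmem _ _ _ (hE i b) this heX (by simp) (by simp)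

lemma orK_not_bwLE {n k : ℕ} (hk : k < n) (hn : 3 * (k * k) + 1 < n * n) :
    ¬ bwLE (underlying (orK n)) k := by
  rintro ⟨m, T, β, hT, hdeg, hβ, hw⟩
  set X : Fin m → Fin m → Set (Sym2 (Fin n ⊕ Fin n)) :=
    fun a b => β '' (leaves T ∩ side T a b) with hXdef
  have hXE : ∀ a b, X a b ⊆ (underlying (orK n)).edgeSet := by
    rintro a b _ ⟨t, ⟨ht, _⟩, rfl⟩
    exact hβ.mapsTo ht
  obtain ⟨t, ht⟩ := exists_sink hT (fun a b => k * k < (X a b).ncard) (by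
    rintro a b hab ⟨h1, h2⟩
    rcases orK_sep hk (X a b) (hXE a b) (hw a b hab) with h | h
    · omega
    · have hsub : X b a ⊆ (underlying (orK n)).edgeSet \ X a b := by
        intro e he
        refine ⟨hXE b a he, ?_⟩
        obtain ⟨u, ⟨hu, hus⟩, rfl⟩ := he
        rintro ⟨v, ⟨hv, hvs⟩, hvu⟩
        have := hβ.injOn hv hu hvu
        subst this
        exact side_disjoint hT hab _ hvs hus
      have := Set.ncard_le_ncard hsub (Set.toFinite _)
      omega)
  have hcov : (underlying (orK n)).edgeSet ⊆
      {β t} ∪ ⋃ s ∈ (T.neighborSet t).toFinset, X t s := by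
    intro e he
    obtain ⟨u, hu, rfl⟩ := hβ.surjOn he
    rcases cover_sides hT t u with rfl | ⟨s, hs, hus⟩
    · left; rfl
    · right
      simp only [Set.mem_iUnion]
      exact ⟨s, by simpa using hs, u, ⟨hu, hus⟩, rfl⟩
  have h1 := Set.ncard_le_ncard hcov (Set.toFinite _)
  have h2 := Set.ncard_union_le {β t} (⋃ s ∈ (T.neighborSet t).toFinset, X t s)
  have h3 : (⋃ s ∈ (T.neighborSet t).toFinset, X t s).ncard ≤
      ∑ s ∈ (T.neighborSet t).toFinset, (X t s).ncard :=
    Finset.set_ncard_biUnion_le _ _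
  have h4 : ∑ s ∈ (T.neighborSet t).toFinset, (X t s).ncard ≤
      (T.neighborSet t).toFinset.card * (k * k) := by
    rw [← smul_eq_mul]
    refine Finset.sum_le_card_nsmul _ _ _ ?_
    intro s hs
    have := ht s (by simpa using hs)
    simpa using this
  have h5 : (T.neighborSet t).toFinset.card ≤ 3 := by
    rw [← Set.ncard_eq_toFinset_card']
    exact hdeg t
  have h6 := Nat.mul_le_mul_right (k * k) h5
  rw [orK_ncard] at h1
  rw [Set.ncard_singleton] at h2
  omega

/-! ### Caterpillars -/

def catParent (v : ℕ) : ℕ := if v % 2 = 1 then v - 1 else v - 2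

def cat (N : ℕ) : SimpleGraph (Fin (2 * N)) where
  Adj a b := (a.val < b.val ∧ a.val = catParent b.val) ∨ (b.val < a.val ∧ b.val = catParent a.val)
  symm := ⟨fun _ _ h => h.symm⟩
  loopless := ⟨fun a h => by rcases h with h | h <;> exact lt_irrefl _ h.1⟩

lemma cat_isTree {N : ℕ} (hN : 2 ≤ N) : (cat N).IsTree := by
  have hlt : ∀ v, 0 < v → catParent v < v := by
    intro v hv; unfold catParent; split <;> omega
  have hreach : ∀ v, ∀ h : v < 2 * N, (cat N).Reachable ⟨0, by omega⟩ ⟨v, h⟩ := by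
    intro v
    induction v using Nat.strong_induction_on with
    | _ v ih =>
      intro h
      rcases Nat.eq_zero_or_pos v with rfl | hv
      · exact SimpleGraph.Reachable.refl _
      · have h1 := hlt v hv
        refine (ih _ h1 (by omega)).trans (SimpleGraph.Adj.reachable ?_)
        exact Or.inl ⟨h1, rfl⟩
  have hconn : (cat N).Connected := by
    haveI : Nonempty (Fin (2 * N)) := ⟨⟨0, by omega⟩⟩
    refine ⟨fun a b => ?_⟩
    exact (hreach a.1 a.2).symm.trans (hreach b.1 b.2)
  rw [SimpleGraph.isTree_iff_connected_and_card]
  refine ⟨hconn, le_antisymm ?_ hconn.card_vert_le_card_edgeSet_add_one⟩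
  have hsub : (cat N).edgeSet ⊆ (fun v : Fin (2 * N) =>
      s((⟨catParent v.1, by
        rcases Nat.eq_zero_or_pos v.1 with h | h
        · rw [h]; unfold catParent; simp; omega
        · have := hlt _ h; omega⟩ : Fin (2 * N)), v)) '' {v | v ≠ ⟨0, by omega⟩} := by
    intro e
    induction e using Sym2.ind with
    | _ x y =>
      intro h
      rcases h with ⟨h1, h2⟩ | ⟨h1, h2⟩
      · refine ⟨y, ?_, ?_⟩
        · intro h; rw [h] at h1; simp at h1
        · simp only [← h2]
      · refine ⟨x, ?_, ?_⟩
        · intro h; rw [h] at h1; simp at h1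
        · simp only [← h2]
          exact Sym2.eq_swap
  have h1 := (Set.ncard_le_ncard hsub (Set.toFinite _)).trans (Set.ncard_image_le (Set.toFinite _))
  have h2 : ({v | v ≠ ⟨0, by omega⟩} : Set (Fin (2 * N))).ncard + 1 = 2 * N := by
    have := Set.ncard_add_ncard_compl ({⟨0, by omega⟩} : Set (Fin (2 * N)))
    rw [Set.ncard_singleton, Nat.card_fin] at this
    rw [add_comm] at this
    exact this
  rw [Nat.card_coe_set_eq, Nat.card_fin]
  omega

lemma cat_adj {N : ℕ} {a b : Fin (2 * N)} : (cat N).Adj a b ↔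
    (a.val < b.val ∧ a.val = catParent b.val) ∨ (b.val < a.val ∧ b.val = catParent a.val) :=
  Iff.rfl

lemma cat_deg (N : ℕ) : maxDegLE3 (cat N) := by
  intro t
  have : Fin.val '' ((cat N).neighborSet t) ⊆ 
      (({catParent t.1, t.1 + 1, t.1 + 2} : Finset ℕ) : Set ℕ) := by
    rintro _ ⟨s, hs, rfl⟩
    rw [SimpleGraph.mem_neighborSet, cat_adj] at hs
    simp only [Finset.coe_insert, Finset.coe_singleton, Set.mem_insert_iff,
      Set.mem_singleton_iff]
    unfold catParent at *
    split_ifs at * <;> omega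
  have h := Set.ncard_le_ncard this (Finset.finite_toSet _)
  rw [Set.ncard_image_of_injective _ Fin.val_injective, Set.ncard_coe_finset] at h
  exact h.trans Finset.card_le_three

lemma cat_leaves {N : ℕ} (hN : 2 ≤ N) : leaves (cat N) = {t | t.val % 2 = 1} := by
  ext t
  have ht := t.2
  simp only [leaves, Set.mem_setOf_eq]
  constructor
  · intro h
    by_contra hodd
    have h1 : (⟨t.1 + 1, by omega⟩ : Fin (2 * N)) ∈ (cat N).neighborSet t := by
      rw [SimpleGraph.mem_neighborSet, cat_adj]
      unfold catParent
      left
      simp only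
      split_ifs <;> omega
    by_cases h0 : t.1 = 0
    · have h2 : (⟨2, by omega⟩ : Fin (2 * N)) ∈ (cat N).neighborSet t := by
        rw [SimpleGraph.mem_neighborSet, cat_adj]
        left
        simp [h0, catParent]
      have := congrArg Fin.val (h h1 h2)
      simp only at this
      omega
    · have h2 : (⟨t.1 - 2, by omega⟩ : Fin (2 * N)) ∈ (cat N).neighborSet t := by
        rw [SimpleGraph.mem_neighborSet, cat_adj]
        unfold catParent
        right
        simp only
        split_ifs
        omega
      have := congrArg Fin.val (h h1 h2)
      simp only at this
      omega
  · intro h a ha b hb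
    rw [SimpleGraph.mem_neighborSet, cat_adj] at ha hb
    ext
    unfold catParent at *
    split_ifs at * <;> omega

lemma exists_bwLE {V : Type} [Finite V] (G : SimpleGraph V) (hG : 2 ≤ G.edgeSet.ncard) :
    ∃ k, bwLE G k := by
  obtain ⟨N, hN⟩ : ∃ N, N = G.edgeSet.ncard := ⟨_, rfl⟩
  rw [← hN] at hG
  have e : Fin N ≃ G.edgeSet := 
    (Finite.equivFinOfCardEq (by rw [Nat.card_coe_set_eq, hN])).symm
  refine ⟨Nat.card V, 2 * N, cat N, fun v => (e ⟨v.1 / 2, by omega⟩).1, cat_isTree hG,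
    cat_deg N, ?_, ?_⟩
  · rw [cat_leaves hG]
    refine ⟨fun v _ => (e _).2, ?_, ?_⟩
    · intro a ha b hb hab
      have := congrArg Fin.val (e.injective (Subtype.ext hab))
      simp only [Set.mem_setOf_eq] at *
      ext
      omega
    · intro x hx
      refine ⟨⟨2 * (e.symm ⟨x, hx⟩).1 + 1, by omega⟩, ?_, ?_⟩
      · simp only [Set.mem_setOf_eq]; omega
      · have h : (⟨(2 * (e.symm ⟨x, hx⟩).1 + 1) / 2, by omega⟩ : Fin N) = e.symm ⟨x, hx⟩ := by
          ext; simp only; omega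
        simp only [h, Equiv.apply_symm_apply]
  · intro a b _
    exact Set.ncard_le_card _

lemma orK_bw (c : ℕ) : c < bw (underlying (orK (2 * c + 2))) := by
  by_contra hcon
  push Not at hcon
  have hmem : bwLE (underlying (orK (2 * c + 2))) (bw (underlying (orK (2 * c + 2)))) := by
    refine Nat.sInf_mem (s := {k | bwLE (underlying (orK (2 * c + 2))) k}) ?_
    refine exists_bwLE _ ?_
    rw [orK_ncard]
    nlinarith
  refine orK_not_bwLE (by omega) ?_ hmem
  nlinarith [Nat.mul_le_mul hcon hcon]

theorem no_function_bounding_bw_by_dbw :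
    (¬∃ f : ℕ → ℕ, ∀ (V : Type) (_ : Fintype V) (D : Digraph V),
        bw (underlying D) ≤ f (dbw D)) ∧
    (∃ (V : ℕ → Type) (_ : ∀ n, Fintype (V n)) (Ds : ∀ n, Digraph (V n)),
        (∀ n, dbw (Ds n) = 0) ∧ ∀ c : ℕ, ∃ n, c < bw (underlying (Ds n))) := by
  constructor
  · rintro ⟨f, hf⟩
    have h1 := hf _ inferInstance (orK (2 * f 0 + 2))
    rw [orK_dbw] at h1
    exact absurd (orK_bw (f 0)) (by omega)
  · exact ⟨fun n => Fin n ⊕ Fin n, fun n => inferInstance, orK, orK_dbw,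
      fun c => ⟨2 * c + 2, orK_bw c⟩⟩
end

section
/- Let H and D be digraphs. If H is equivalent to D under source-sink identification, then dbw(H) = dbw(D). -/
open scoped Classical

namespace SSI

theorem reach_map {A B : Type} {G : SimpleGraph A} {G' : SimpleGraph B} (φ : A → B)
    (h : ∀ u v, G.Adj u v → φ u = φ v ∨ G'.Adj (φ u) (φ v)) {u v : A}
    (huv : G.Reachable u v) : G'.Reachable (φ u) (φ v) := by
  obtain ⟨w⟩ := huv
  induction w with
  | nil => exact SimpleGraph.Reachable.refl _
  | cons hadj _ ih =>
    rcases h _ _ hadj with h1 | h1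
    · rw [h1]; exact ih
    · exact h1.reachable.trans ih

theorem pair_le {A : Type} (a b : A) : ({a, b} : Set A).ncard ≤ 2 := by
  have := Set.ncard_insert_le a {b}
  rwa [Set.ncard_singleton] at this

theorem mem_biSep {V : Type} (D : Digraph V) (X : Set (V × V)) (v : V) :
    v ∈ biSep D X ↔ ∃ u w, D.Adj u v ∧ D.Adj v w ∧ ¬((u, v) ∈ X ↔ (v, w) ∈ X) := by
  constructor
  · rintro (⟨u, w, h1, h2, h3, h4⟩ | ⟨u, w, h1, h2, h3, h4⟩)
    · exact ⟨u, w, h1, h3, by tauto⟩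
    · refine ⟨u, w, h1, h3, ?_⟩
      have h5 : (u, v) ∈ X := by
        by_contra h
        exact h2 ⟨h1, h⟩
      have h6 := h4.2
      tauto
  · rintro ⟨u, w, h1, h2, h3⟩
    by_cases hu : (u, v) ∈ X
    · right
      exact ⟨u, w, h1, fun h => h.2 hu, h2, h2, by tauto⟩
    · left
      exact ⟨u, w, h1, hu, h2, by tauto⟩

theorem side_leaf {T : Type} {G : SimpleGraph T} {a l : T} (hl : l ∈ leaves G)
    (ha : G.Adj a l) : side G a l = {l} := by
  ext t
  constructor
  · rintro ⟨w⟩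
    cases w with
    | nil => rfl
    | cons h _ =>
      rw [SimpleGraph.deleteEdges_adj] at h
      have := hl h.1 ha.symm
      subst this
      exact absurd (Sym2.eq_swap) h.2
  · rintro rfl
    exact SimpleGraph.Reachable.refl _

theorem side_leaf' {T : Type} {G : SimpleGraph T} (hc : G.Connected) {a l : T}
    (hl : l ∈ leaves G) (ha : G.Adj a l) : side G l a = {l}ᶜ := by
  ext t
  constructor
  · rintro h rfl
    have h2 : a ∈ side G a t := by
      have := h.symm
      rwa [Sym2.eq_swap] at this
    rw [side_leaf hl ha] at h2
    exact ha.ne h2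
  · intro h
    have h1 := hc.preconnected a t
    have h2 := reach_map (G' := G.deleteEdges {s(l, a)}) (fun u => if u = l then a else u) (by
      intro u v huv
      by_cases hu : u = l
      · subst hu
        have := hl huv ha.symm
        subst this
        left; simp
      by_cases hv : v = l
      · subst hv
        have := hl huv.symm ha.symm
        subst this
        left; simp
      right
      simp only [hu, hv, if_false, SimpleGraph.deleteEdges_adj]
      refine ⟨huv, ?_⟩
      simp [Sym2.eq_iff, hu, hv]) h1
    simp only [ha.ne, show t ≠ l from h, if_false] at h2
    exact h2

/-- Relaxed form of `dbwLE`, with unused leaves allowed. -/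
def rel {V : Type} (D : Digraph V) (k : ℕ) (T : Type) : Prop :=
  ∃ (G : SimpleGraph T) (γ : V × V → T), G.IsTree ∧ maxDegLE3 G ∧
    Set.InjOn γ D.edgeSet' ∧ (∀ e ∈ D.edgeSet', γ e ∈ leaves G) ∧
    ∀ a b, G.Adj a b → (biSep D {e | e ∈ D.edgeSet' ∧ γ e ∈ side G a b}).ncard ≤ k

theorem rel_of_dbwLE {V : Type} {D : Digraph V} {k : ℕ} (h : dbwLE D k) :
    ∃ m : ℕ, rel D k (Fin m) := by
  obtain ⟨m, G, β, hT, hd, hb, hk⟩ := h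
  have : Nonempty (Fin m) := hT.connected.nonempty
  refine ⟨m, G, Function.invFunOn β (leaves G), hT, hd, ?_, ?_, ?_⟩
  · exact Function.invFunOn_injOn_image β (leaves G) |>.mono hb.image_eq.ge
  · intro e he
    exact Function.invFunOn_mem (hb.surjOn he)
  · intro a b hab
    convert hk a b hab using 3
    ext e
    constructor
    · rintro ⟨he, h2⟩
      exact ⟨_, ⟨Function.invFunOn_mem (hb.surjOn he), h2⟩, Function.invFunOn_eq (hb.surjOn he)⟩
    · rintro ⟨t, ⟨h1, h2⟩, rfl⟩
      refine ⟨hb.mapsTo h1, ?_⟩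
      rwa [hb.injOn.leftInvOn_invFunOn h1]

theorem rel_iso {V : Type} {D : Digraph V} {k : ℕ} {T S : Type} [Finite T] (e : T ≃ S)
    (h : rel D k T) : rel D k S := by
  obtain ⟨G, γ, hT, hd, hi, hl, hk⟩ := h
  have hmap : ∀ a b, (G.comap e.symm).Adj a b ↔ G.Adj (e.symm a) (e.symm b) := fun _ _ => Iff.rfl
  refine ⟨G.comap e.symm, e ∘ γ, ?_, ?_, ?_, ?_, ?_⟩
  · exact (SimpleGraph.Iso.isTree_iff (SimpleGraph.Iso.comap e.symm G)).2 hT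
  · intro t
    refine le_trans ?_ (hd (e.symm t))
    exact Set.ncard_le_ncard_of_injOn e.symm (fun a ha => ha) e.symm.injective.injOn
  · exact e.injective.comp_injOn hi
  · intro x hx a ha b hb
    apply e.symm.injective
    have ha' : G.Adj (γ x) (e.symm a) := by simpa using ha
    have hb' : G.Adj (γ x) (e.symm b) := by simpa using hb
    exact hl x hx ha' hb'
  · intro a b hab
    convert hk _ _ hab using 3
    ext x
    refine and_congr_right fun _ => ?_
    constructor
    · intro h
      have := reach_map (G' := G.deleteEdges {s(e.symm a, e.symm b)}) e.symm (by
        intro u v huv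
        right
        rw [SimpleGraph.deleteEdges_adj] at huv ⊢
        refine ⟨huv.1, ?_⟩
        have := huv.2
        simpa [Sym2.eq_iff] using this) h
      simp only [Function.comp_apply, Equiv.symm_apply_apply] at this
      exact this
    · intro h
      have := reach_map (G' := (G.comap e.symm).deleteEdges {s(a, b)}) e (by
        intro u v huv
        right
        rw [SimpleGraph.deleteEdges_adj] at huv ⊢
        refine ⟨by simpa using huv.1, ?_⟩
        have := huv.2
        simpa [Sym2.eq_iff, Equiv.eq_symm_apply] using this) h
      simp only [Equiv.apply_symm_apply] at this
      exact this

theorem rel_prune {V : Type} {D : Digraph V} {k : ℕ} {T : Type} [Finite T]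
    (G : SimpleGraph T) (γ : V × V → T) (hT : G.IsTree) (hd : maxDegLE3 G)
    (hi : Set.InjOn γ D.edgeSet') (hl : ∀ e ∈ D.edgeSet', γ e ∈ leaves G)
    (hk : ∀ a b, G.Adj a b → (biSep D {e | e ∈ D.edgeSet' ∧ γ e ∈ side G a b}).ncard ≤ k)
    (l : T) (hll : l ∈ leaves G) (hlu : ∀ e ∈ D.edgeSet', γ e ≠ l)
    (hne : D.edgeSet'.Nonempty) : rel D k {t : T // t ≠ l} := by
  obtain ⟨e0, he0⟩ := hne
  have : Nontrivial T := ⟨⟨_, _, hlu e0 he0⟩⟩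
  obtain ⟨p, hp⟩ := hT.connected.preconnected.exists_adj_of_nontrivial l
  let r0 : {t : T // t ≠ l} := ⟨γ e0, hlu e0 he0⟩
  let π : T → {t : T // t ≠ l} := fun t => if h : t = l then ⟨p, hp.ne'⟩ else ⟨t, h⟩
  have hπ : ∀ t : {t : T // t ≠ l}, π t = t := by
    rintro ⟨t, ht⟩
    simp [π, ht]
  have key : ∀ u v, G.Adj u v → π u = π v ∨ (u ≠ l ∧ v ≠ l) := by
    intro u v huv
    by_cases hu : u = l
    · subst hu
      have := hll huv hp
      subst this
      left; simp [π, hp.ne']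
    by_cases hv : v = l
    · subst hv
      have := hll huv.symm hp
      subst this
      left; simp [π, hp.ne']
    exact Or.inr ⟨hu, hv⟩
  refine ⟨G.comap Subtype.val, fun e => if h : γ e = l then r0 else ⟨γ e, h⟩, ⟨?_, ?_⟩,
    ?_, ?_, ?_, ?_⟩
  · have : Nonempty {t : T // t ≠ l} := ⟨r0⟩
    refine SimpleGraph.Connected.mk ?_
    intro a b
    have := reach_map (G' := G.comap (Subtype.val : {t : T // t ≠ l} → T)) π (by
      intro u v huv
      rcases key u v huv with h | ⟨h1, h2⟩
      · exact Or.inl h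
      · right
        have e1 := hπ ⟨u, h1⟩
        have e2 := hπ ⟨v, h2⟩
        simp only at e1 e2
        rw [e1, e2]
        exact huv) (hT.connected.preconnected a.1 b.1)
    rwa [hπ, hπ] at this
  · exact hT.isAcyclic.comap ⟨Subtype.val, fun h => h⟩ Subtype.val_injective
  · intro t
    refine le_trans ?_ (hd t.1)
    exact Set.ncard_le_ncard_of_injOn Subtype.val (fun a ha => ha) Subtype.val_injective.injOn
  · intro e he e' he' hee
    simp only [hlu e he, hlu e' he', dif_neg, not_false_eq_true, Subtype.mk.injEq] at hee
    exact hi he he' hee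
  · intro e he a ha b hb
    simp only [hlu e he, dif_neg, not_false_eq_true] at ha hb
    exact Subtype.ext (hl e he ha hb)
  · intro a b hab
    convert hk _ _ hab using 3
    ext x
    refine and_congr_right fun hx => ?_
    simp only [hlu x hx, dif_neg, not_false_eq_true]
    constructor
    · intro h
      exact reach_map (G' := G.deleteEdges {s(a.1, b.1)}) Subtype.val (by
        intro u v huv
        right
        rw [SimpleGraph.deleteEdges_adj] at huv ⊢
        refine ⟨huv.1, ?_⟩
        have := huv.2
        simpa [Sym2.eq_iff, Subtype.ext_iff] using this) h
    · intro h
      have := reach_map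
        (G' := (G.comap (Subtype.val : {t : T // t ≠ l} → T)).deleteEdges {s(a, b)}) π (by
        intro u v huv
        rw [SimpleGraph.deleteEdges_adj] at huv
        rcases key u v huv.1 with h | ⟨h1, h2⟩
        · exact Or.inl h
        · right
          have e1 := hπ ⟨u, h1⟩
          have e2 := hπ ⟨v, h2⟩
          simp only at e1 e2
          rw [e1, e2, SimpleGraph.deleteEdges_adj]
          refine ⟨huv.1, ?_⟩
          have := huv.2
          simpa [Sym2.eq_iff, Subtype.ext_iff] using this) h
      rw [hπ] at this
      have e2 := hπ ⟨γ x, hlu x hx⟩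
      simp only at e2
      rwa [e2] at this

theorem dbwLE_of_rel {V : Type} {D : Digraph V} {k : ℕ} (hne : D.edgeSet'.Nonempty) :
    ∀ m : ℕ, rel D k (Fin m) → dbwLE D k := by
  intro m
  induction m using Nat.strong_induction_on with
  | _ m ih =>
  rintro ⟨G, γ, hT, hd, hi, hl, hk⟩
  by_cases hall : ∀ l ∈ leaves G, ∃ e ∈ D.edgeSet', γ e = l
  · obtain ⟨e0, he0⟩ := hne
    have : Nonempty (V × V) := ⟨e0⟩
    have hs : Set.SurjOn γ D.edgeSet' (leaves G) := fun l hl => hall l hl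
    have hb : Set.BijOn γ D.edgeSet' (leaves G) := ⟨hl, hi, hs⟩
    have hinv := hb.invOn_invFunOn
    refine ⟨m, G, Function.invFunOn γ D.edgeSet', hT, hd, ?_, ?_⟩
    · exact hinv.symm.bijOn hs.mapsTo_invFunOn hb.mapsTo
    · intro a b hab
      convert hk a b hab using 3
      ext e
      constructor
      · rintro ⟨t, ⟨h1, h2⟩, rfl⟩
        refine ⟨hs.mapsTo_invFunOn h1, ?_⟩
        rwa [hinv.2 h1]
      · rintro ⟨he, h2⟩
        exact ⟨γ e, ⟨hl e he, h2⟩, hinv.1 he⟩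
  · push Not at hall
    obtain ⟨l, hll, hlu⟩ := hall
    have h1 := rel_prune G γ hT hd hi hl hk l hll hlu hne
    have hc : Fintype.card {t : Fin m // t ≠ l} < m := by
      conv_rhs => rw [← Fintype.card_fin m]
      exact Fintype.card_subtype_lt (x := l) (by simp)
    exact ih _ hc (rel_iso (Fintype.equivFin _) h1)

/-- Attach pendants. -/
def pend {T P : Type} (G : SimpleGraph T) (f : P → T) : SimpleGraph (T ⊕ P) where
  Adj u v := match u, v with
    | Sum.inl a, Sum.inl b => G.Adj a b
    | Sum.inl a, Sum.inr p => f p = a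
    | Sum.inr p, Sum.inl a => f p = a
    | Sum.inr _, Sum.inr _ => False
  symm := ⟨by
    rintro (a | a) (b | b) h
    · exact G.adj_symm h
    · exact h
    · exact h
    · exact h⟩
  loopless := ⟨by
    rintro (a | a) h
    · exact G.loopless.irrefl a h
    · exact h⟩

theorem pend_leaf {T P : Type} (G : SimpleGraph T) (f : P → T) (p : P) :
    Sum.inr p ∈ leaves (pend G f) := by
  rintro (a | a) ha (b | b) hb
  · have ha' : f p = a := ha
    have hb' : f p = b := hb
    rw [← ha', ← hb']
  · exact hb.elim
  · exact ha.elim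
  · exact ha.elim

theorem pend_side {T P : Type} (G : SimpleGraph T) (f : P → T) (a b : T) (hab : G.Adj a b)
    (t : T ⊕ P) :
    t ∈ side (pend G f) (Sum.inl a) (Sum.inl b) ↔ Sum.elim id f t ∈ side G a b := by
  constructor
  · intro h
    exact reach_map (G' := G.deleteEdges {s(a, b)}) (Sum.elim id f) (by
      rintro (u | u) (v | v) huv
      · right
        rw [SimpleGraph.deleteEdges_adj] at huv ⊢
        refine ⟨huv.1, ?_⟩
        have := huv.2
        simpa [Sym2.eq_iff] using this
      · left; exact Eq.symm (SimpleGraph.deleteEdges_adj.1 huv).1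
      · left; exact (SimpleGraph.deleteEdges_adj.1 huv).1
      · exact (SimpleGraph.deleteEdges_adj.1 huv).1.elim) h
  · intro h
    have h1 := reach_map (G' := (pend G f).deleteEdges {s(Sum.inl a, Sum.inl b)}) Sum.inl (by
      intro u v huv
      right
      rw [SimpleGraph.deleteEdges_adj] at huv ⊢
      refine ⟨huv.1, ?_⟩
      have := huv.2
      simpa [Sym2.eq_iff] using this) h
    rcases t with t | p
    · exact h1
    · refine SimpleGraph.Reachable.trans h1 (SimpleGraph.Adj.reachable ?_)
      rw [SimpleGraph.deleteEdges_adj]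
      refine ⟨rfl, ?_⟩
      simp [Sym2.eq_iff]

theorem pend_tree {T P : Type} {G : SimpleGraph T} (f : P → T) (hT : G.IsTree) :
    (pend G f).IsTree := by
  have hleaf : ∀ p : P, (pend G f).Adj (Sum.inl (f p)) (Sum.inr p) := fun p => rfl
  refine ⟨?_, ?_⟩
  · have : Nonempty T := hT.connected.nonempty
    refine SimpleGraph.Connected.mk ?_
    have h1 : ∀ a b : T, (pend G f).Reachable (Sum.inl a) (Sum.inl b) := fun a b =>
      reach_map Sum.inl (fun u v huv => Or.inr huv) (hT.connected.preconnected a b)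
    rintro (a | a) (b | b)
    · exact h1 a b
    · exact (h1 a (f b)).trans (hleaf b).reachable
    · exact (hleaf a).reachable.symm.trans (h1 (f a) b)
    · exact ((hleaf a).reachable.symm.trans (h1 (f a) (f b))).trans (hleaf b).reachable
  · rw [SimpleGraph.isAcyclic_iff_forall_adj_isBridge]
    have hpen : ∀ p : P, (pend G f).IsBridge s(Sum.inl (f p), Sum.inr p) := by
      intro p
      rw [SimpleGraph.isBridge_iff]
      intro h
      have h2 : Sum.inl (f p) ∈ side (pend G f) (Sum.inl (f p)) (Sum.inr p) := h.symm
      rw [side_leaf (pend_leaf G f p) (hleaf p)] at h2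
      simp at h2
    rintro (a | a) (b | b) hab
    · rw [SimpleGraph.isBridge_iff]
      intro h
      have h2 := (pend_side G f a b hab (Sum.inl a)).1 h.symm
      have h3 := SimpleGraph.isAcyclic_iff_forall_adj_isBridge.1 hT.isAcyclic hab
      rw [SimpleGraph.isBridge_iff] at h3
      exact h3 h2.symm
    · have hab' : f b = a := hab
      subst hab'
      exact hpen b
    · have hab' : f a = b := hab
      subst hab'
      rw [Sym2.eq_swap]
      exact hpen a
    · exact hab.elim

/-- Abstract properties of an identification map. -/
structure IdMap {V : Type} (D H : Digraph V) (c : V → V) : Prop where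
  fwd : ∀ u v, D.Adj u v → H.Adj (c u) (c v)
  lift : ∀ a b, H.Adj a b → ∃ u v, D.Adj u v ∧ c u = a ∧ c v = b
  fixD : ∀ u v w, D.Adj u v → D.Adj v w → c v = v
  fixH : ∀ a b d, H.Adj a b → H.Adj b d → ∀ v, c v = b → v = b
  fib : ∀ e, {p : V × V | D.Adj p.1 p.2 ∧ (c p.1, c p.2) = e}.ncard ≤ 2

theorem idMap_of_step {V : Type} [Fintype V] {D H : Digraph V} (h : identStep D H) :
    ∃ c, IdMap D H c := by
  obtain ⟨x, y, hxy, hs, rfl⟩ := h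
  refine ⟨fun v => if v = y then x else v, ?_, ?_, ?_, ?_, ?_⟩
  · intro u v huv
    refine ⟨?_, ?_, u, v, rfl, rfl, huv⟩
    · split_ifs <;> assumption
    · split_ifs <;> assumption
  · rintro a b ⟨_, _, u, v, h1, h2, h3⟩
    exact ⟨u, v, h3, h1, h2⟩
  · intro u v w huv hvw
    have : v ≠ y := by
      rintro rfl
      rcases hs with ⟨_, h⟩ | ⟨_, h⟩
      · exact h _ huv
      · exact h _ hvw
    simp [this]
  · rintro a b d ⟨_, hb, u, v, h1, h2, h3⟩ ⟨_, _, u', v', h4, h5, h6⟩ w hw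
    have hbx : b ≠ x := by
      rintro rfl
      rcases hs with ⟨hx, hy⟩ | ⟨hx, hy⟩
      · by_cases hv : v = y
        · subst hv; exact hy _ h3
        · simp only [hv, if_false] at h2
          subst h2; exact hx _ h3
      · by_cases hv : u' = y
        · subst hv; exact hy _ h6
        · simp only [hv, if_false] at h4
          subst h4; exact hx _ h6
    by_cases hwy : w = y
    · simp only [hwy, if_true] at hw
      exact absurd hw.symm hbx
    · simpa [hwy] using hw
  · rintro ⟨a, b⟩
    rcases hs with ⟨hx, hy⟩ | ⟨hx, hy⟩
    · refine le_trans (Set.ncard_le_ncard (t := {(a, b), (y, b)}) ?_) (pair_le _ _)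
      rintro ⟨u, v⟩ ⟨h1, h2⟩
      simp only [Prod.mk.injEq] at h1 h2
      have hv : v ≠ y := by rintro rfl; exact hy _ h1
      simp only [hv, if_false] at h2
      by_cases hu : u = y
      · right; simp [hu, h2.2]
      · left; simp only [hu, if_false] at h2; simp [h2]
    · refine le_trans (Set.ncard_le_ncard (t := {(a, b), (a, y)}) ?_) (pair_le _ _)
      rintro ⟨u, v⟩ ⟨h1, h2⟩
      simp only [Prod.mk.injEq] at h1 h2
      have hu : u ≠ y := by rintro rfl; exact hy _ h1
      simp only [hu, if_false] at h2
      by_cases hv : v = y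
      · right; simp [hv, h2.1]
      · left; simp only [hv, if_false] at h2; simp [h2]

theorem rel_down {V : Type} [Fintype V] {D H : Digraph V} {c : V → V} (hc : IdMap D H c)
    {k : ℕ} {T : Type} (h : rel D k T) : rel H k T := by
  obtain ⟨G, γ, hT, hd, hi, hl, hk⟩ := h
  have hex : ∀ e : V × V, ∃ p : V × V, e ∈ H.edgeSet' →
      (p ∈ D.edgeSet' ∧ (c p.1, c p.2) = e) := by
    intro e
    by_cases he : e ∈ H.edgeSet'
    · obtain ⟨u, v, h1, h2, h3⟩ := hc.lift _ _ he
      exact ⟨(u, v), fun _ => ⟨h1, by simp [h2, h3]⟩⟩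
    · exact ⟨e, fun h => absurd h he⟩
  choose s hs using hex
  refine ⟨G, γ ∘ s, hT, hd, ?_, ?_, ?_⟩
  · intro e he e' he' hee
    have := hi (hs e he).1 (hs e' he').1 hee
    rw [← (hs e he).2, ← (hs e' he').2, this]
  · intro e he
    exact hl _ (hs e he).1
  · intro a b hab
    refine le_trans (Set.ncard_le_ncard ?_) (hk a b hab)
    intro v hv
    rw [mem_biSep] at hv ⊢
    obtain ⟨u, w, h1, h2, h3⟩ := hv
    obtain ⟨p1, p2⟩ := hs (u, v) h1
    obtain ⟨q1, q2⟩ := hs (v, w) h2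
    have e1 : (s (u, v)).2 = v := hc.fixH _ _ _ h1 h2 _ (congrArg Prod.snd p2)
    have e2 : (s (v, w)).1 = v := hc.fixH _ _ _ h1 h2 _ (congrArg Prod.fst q2)
    have e1' : s (u, v) = ((s (u, v)).1, v) := Prod.ext rfl e1
    have e2' : s (v, w) = (v, (s (v, w)).2) := Prod.ext e2 rfl
    refine ⟨(s (u, v)).1, (s (v, w)).2, ?_, ?_, ?_⟩
    · rw [e1'] at p1; exact p1
    · rw [e2'] at q1; exact q1
    · rw [← e1', ← e2']
      intro h4
      apply h3
      constructor
      · intro h5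
        exact ⟨h2, (h4.1 ⟨p1, h5.2⟩).2⟩
      · intro h5
        exact ⟨h1, (h4.2 ⟨q1, h5.2⟩).2⟩

theorem biSep_lift {V : Type} {D H : Digraph V} {c : V → V} (hc : IdMap D H c)
    (X Y : Set (V × V)) (hXY : ∀ u v w, D.Adj u v → D.Adj v w →
      ((c u, c v) ∈ Y ↔ (c v, c w) ∈ Y) → ((u, v) ∈ X ↔ (v, w) ∈ X)) :
    biSep D X ⊆ biSep H Y := by
  intro v hv
  rw [mem_biSep] at hv ⊢
  obtain ⟨u, w, h1, h2, h3⟩ := hv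
  have e := hc.fixD _ _ _ h1 h2
  have h4 := hc.fwd _ _ h1
  have h5 := hc.fwd _ _ h2
  have h6 := fun h => h3 (hXY u v w h1 h2 h)
  rw [e] at h4 h5 h6
  exact ⟨c u, c w, h4, h5, h6⟩

theorem rel_up {V : Type} [Fintype V] {D H : Digraph V} {c : V → V} (hc : IdMap D H c)
    {k : ℕ} {T : Type} [Finite T] (h : rel H k T) : rel D k (T ⊕ D.edgeSet') := by
  obtain ⟨G, γ, hT, hd, hi, hl, hk⟩ := h
  have hN : Nonempty T := hT.connected.nonempty
  obtain ⟨t0⟩ := hN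
  let φ : V × V → V × V := fun p => (c p.1, c p.2)
  have hφ : ∀ p ∈ D.edgeSet', φ p ∈ H.edgeSet' := fun p hp => hc.fwd _ _ hp
  let f : D.edgeSet' → T := fun p => γ (φ p)
  let δ : V × V → T ⊕ D.edgeSet' := fun e => if h : e ∈ D.edgeSet' then Sum.inr ⟨e, h⟩ else Sum.inl t0
  have hδ : ∀ e (h : e ∈ D.edgeSet'), δ e = Sum.inr ⟨e, h⟩ := fun e h => dif_pos h
  -- single-edge cuts
  have hsingle : ∀ p ∈ D.edgeSet', ∀ X : Set (V × V),
      (∀ q ∈ D.edgeSet', ∀ r ∈ D.edgeSet', ((q = p ↔ r = p) → (q ∈ X ↔ r ∈ X))) →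
      (biSep D X).ncard ≤ k := by
    intro p hp X hX
    have hsub : biSep D X ⊆ biSep H {φ p} := by
      apply biSep_lift hc
      intro u v w h1 h2 h3
      apply hX (u, v) h1 (v, w) h2
      by_cases hpq : φ (u, v) = φ (v, w)
      · have e := hc.fixD _ _ _ h1 h2
        have h4 := hc.fwd _ _ h1
        have h5 := hc.fwd _ _ h2
        simp only [φ, Prod.mk.injEq] at hpq
        rw [e] at h4 h5 hpq
        have e1 := hc.fixH _ _ _ h4 h5 u hpq.1
        have e2 := hc.fixH _ _ _ h4 h5 w hpq.2.symm
        rw [e1, e2]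
      · have h3' : φ (u, v) = φ p ↔ φ (v, w) = φ p := h3
        constructor
        · intro h; rw [h] at h3' hpq; exact absurd (h3'.1 rfl).symm hpq
        · intro h; rw [h] at h3' hpq; exact absurd (h3'.2 rfl) hpq
    refine le_trans (Set.ncard_le_ncard hsub) ?_
    by_cases hn : Nontrivial T
    · obtain ⟨b, hb⟩ := hT.connected.preconnected.exists_adj_of_nontrivial (γ (φ p))
      have h1 := hk b _ hb.symm
      rw [side_leaf (hl _ (hφ p hp)) hb.symm] at h1
      have heq : ({φ p} : Set (V × V)) = {e | e ∈ H.edgeSet' ∧ γ e ∈ ({γ (φ p)} : Set T)} := ?_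
      · rw [heq]; exact h1
      ext e
      constructor
      · rintro rfl
        exact ⟨hφ p hp, rfl⟩
      · rintro ⟨h1, h2⟩
        exact hi h1 (hφ p hp) h2
    · rw [not_nontrivial_iff_subsingleton] at hn
      have : biSep H {φ p} = ∅ := by
        rw [Set.eq_empty_iff_forall_notMem]
        intro v hv
        rw [mem_biSep] at hv
        obtain ⟨u, w, h1, h2, h3⟩ := hv
        apply h3
        rw [hi (show (u, v) ∈ H.edgeSet' from h1) (show (v, w) ∈ H.edgeSet' from h2)
          (Subsingleton.elim _ _)]
      rw [this]
      simp
  refine ⟨pend G f, δ, pend_tree f hT, ?_, ?_, ?_, ?_⟩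
  · rintro (t | p)
    · have hsub : (pend G f).neighborSet (Sum.inl t) ⊆
          Sum.inl '' G.neighborSet t ∪ Sum.inr '' {p | f p = t} := by
        rintro (u | u) hu
        · left; exact ⟨u, hu, rfl⟩
        · right; exact ⟨u, hu, rfl⟩
      refine le_trans (Set.ncard_le_ncard hsub) (le_trans (Set.ncard_union_le _ _) ?_)
      have i1 : (Sum.inl '' G.neighborSet t : Set (T ⊕ D.edgeSet')).ncard ≤
        (G.neighborSet t).ncard := Set.ncard_image_le
      have i2 : (Sum.inr '' {p | f p = t} : Set (T ⊕ D.edgeSet')).ncard ≤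
        {p | f p = t}.ncard := Set.ncard_image_le
      by_cases hex : ∃ p, f p = t
      · obtain ⟨p, rfl⟩ := hex
        have j1 : (G.neighborSet (f p)).ncard ≤ 1 :=
          Set.ncard_le_one_iff_subsingleton.2 (hl _ (hφ p p.2))
        have j2 : {q | f q = f p}.ncard ≤ 2 := by
          refine le_trans (Set.ncard_le_ncard_of_injOn Subtype.val ?_ Subtype.val_injective.injOn)
            (hc.fib (φ p))
          intro q hq
          exact ⟨q.2, hi (hφ q q.2) (hφ p p.2) hq⟩
        omega
      · have : {p | f p = t} = ∅ := by
          rw [Set.eq_empty_iff_forall_notMem]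
          exact fun p hp => hex ⟨p, hp⟩
        rw [this] at i2 ⊢
        rw [Set.ncard_empty] at i2
        have := hd t
        omega
    · have := Set.ncard_le_one_iff_subsingleton.2 (pend_leaf G f p)
      omega
  · intro e he e' he' hee
    rw [hδ e he, hδ e' he'] at hee
    simpa using hee
  · intro e he
    rw [hδ e he]
    exact pend_leaf G f _
  · have hconn := (pend_tree f hT).connected
    rintro (a | p) (b | q) hab
    · refine le_trans (Set.ncard_le_ncard ?_) (hk a b hab)
      apply biSep_lift hc
      intro u v w h1 h2 h3
      have hh : ∀ e ∈ D.edgeSet', (e ∈ {e | e ∈ D.edgeSet' ∧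
          δ e ∈ side (pend G f) (Sum.inl a) (Sum.inl b)} ↔
          φ e ∈ {e | e ∈ H.edgeSet' ∧ γ e ∈ side G a b}) := by
        intro e he
        have := pend_side G f a b hab (δ e)
        simp only [Set.mem_ofPred_eq, he, hφ e he, true_and]
        rw [this, hδ e he]
        rfl
      rw [hh (u, v) h1, hh (v, w) h2]
      exact h3
    · apply hsingle q.1 q.2
      rw [side_leaf (pend_leaf G f q) hab]
      intro e he e' he' h
      simpa [he, he', hδ, Subtype.ext_iff, hδ e he, hδ e' he'] using h
    · apply hsingle p.1 p.2
      rw [side_leaf' hconn (pend_leaf G f p) hab.symm]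
      intro e he e' he' h
      have h' := not_congr h
      simpa [he, he', Subtype.ext_iff, hδ e he, hδ e' he'] using h'
    · exact hab.elim

theorem dbw_step {V : Type} [Fintype V] {D H : Digraph V} (h : identStep D H) :
    dbw H = dbw D := by
  obtain ⟨c, hc⟩ := idMap_of_step h
  by_cases hne : D.edgeSet'.Nonempty
  · have hneH : H.edgeSet'.Nonempty := by
      obtain ⟨e, he⟩ := hne
      exact ⟨(c e.1, c e.2), hc.fwd _ _ he⟩
    unfold dbw
    congr 1
    ext k
    constructor
    · intro hk
      obtain ⟨m, hm⟩ := rel_of_dbwLE hk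
      exact dbwLE_of_rel hne _ (rel_iso (Fintype.equivFin _) (rel_up hc hm))
    · intro hk
      obtain ⟨m, hm⟩ := rel_of_dbwLE hk
      exact dbwLE_of_rel hneH _ (rel_down hc hm)
  · have : H = D := by
      have h0 : ∀ a b, ¬ D.Adj a b := fun a b hab => hne ⟨(a, b), hab⟩
      ext a b
      refine ⟨fun hab => ?_, fun hab => absurd hab (h0 _ _)⟩
      obtain ⟨u, v, h1, _⟩ := hc.lift _ _ hab
      exact absurd h1 (h0 _ _)
    rw [this]

end SSI

/-- If `H` is equivalent to `D` under source-sink identification, then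
`dbw(H) = dbw(D)`. -/
theorem dbw_invariant_source_sink_identification {V : Type} [Fintype V] (H D : Digraph V)
    (h : Relation.ReflTransGen identStep D H) : dbw H = dbw D := by
  induction h with
  | refl => rfl
  | tail _ hs ih => rw [SSI.dbw_step hs, ih]
end

section
/- If H is a butterfly minor of a digraph D, then dbw(H) ≤ dbw(D). -/
open scoped Classical

/-- Weak decomposition: only some of the leaves of the tree are labelled. -/
def WeakDec {V : Type} (D : Digraph V) (k m : ℕ) : Prop :=
  ∃ (G : SimpleGraph (Fin m)) (β : Fin m → V × V) (L : Set (Fin m)),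
    G.IsTree ∧ maxDegLE3 G ∧ L ⊆ leaves G ∧ Set.BijOn β L D.edgeSet' ∧
    ∀ a b : Fin m, G.Adj a b →
      (biSep D (β '' (L ∩ side G a b))).ncard ≤ k

lemma reachable_retract {S T : Type} {G : SimpleGraph S} {G' : SimpleGraph T} (r : S → T)
    (hr : ∀ u v, G.Adj u v → r u = r v ∨ G'.Adj (r u) (r v)) {u v : S}
    (h : G.Reachable u v) : G'.Reachable (r u) (r v) := by
  obtain ⟨p⟩ := h
  induction p with
  | nil => exact SimpleGraph.Reachable.refl _
  | cons hadj _ ih =>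
    rcases hr _ _ hadj with h | h
    · rw [h]; exact ih
    · exact h.reachable.trans ih

lemma dbwLE_of_weakDec {V : Type} (D : Digraph V) (k : ℕ) (hne : D.edgeSet'.Nonempty) :
    ∀ m, WeakDec D k m → dbwLE D k := by
  intro m
  induction m with
  | zero =>
    rintro ⟨G, β, L, hT, -⟩
    exact hT.connected.nonempty.elim (fun x => x.elim0)
  | succ m ih =>
    rintro ⟨G, β, L, hT, hdeg, hL, hβ, hw⟩
    by_cases hE : leaves G ⊆ L
    · have hLE : L = leaves G := hL.antisymm hE
      subst hLE
      exact ⟨m + 1, G, β, hT, hdeg, hβ, hw⟩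
    obtain ⟨t, ht, htL⟩ := Set.not_subset.1 hE
    have ht' : (G.neighborSet t).Subsingleton := ht
    obtain ⟨e, he⟩ := hne
    obtain ⟨l, hl, -⟩ := hβ.surjOn he
    have hlt : l ≠ t := fun h => htL (h ▸ hl)
    set f : Fin m → Fin (m + 1) := t.succAbove with hf
    have finj : Function.Injective f := Fin.succAbove_right_injective
    have fne : ∀ i, f i ≠ t := fun i => Fin.succAbove_ne t i
    have fsurj : ∀ u, u ≠ t → ∃ i, f i = u := fun u hu => Fin.exists_succAbove_eq hu
    obtain ⟨c, hc⟩ : ∃ c : Fin m, ∀ w, G.Adj t w → w = f c := by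
      by_cases hn : ∃ w, G.Adj t w
      · obtain ⟨w, hw⟩ := hn
        obtain ⟨c, rfl⟩ := fsurj w hw.ne.symm
        exact ⟨c, fun w' hw' => ht' hw' hw⟩
      · obtain ⟨c, rfl⟩ := fsurj l hlt
        exact ⟨c, fun w' hw' => (hn ⟨w', hw'⟩).elim⟩
    obtain ⟨r, hrf, hrt⟩ : ∃ r : Fin (m + 1) → Fin m, (∀ i, r (f i) = i) ∧ r t = c := by
      choose g hg using fsurj
      refine ⟨fun u => if h : u ≠ t then g u h else c, fun i => ?_, by simp⟩
      simp only [fne i, ne_eq, not_false_eq_true, dif_pos]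
      exact finj (hg _ _)
    have hr : ∀ u v, G.Adj u v → r u = r v ∨
        (∃ i j, u = f i ∧ v = f j) := by
      intro u v huv
      by_cases hu : u = t
      · subst hu
        left
        rw [hc v huv, hrf, hrt]
      by_cases hv : v = t
      · subst hv
        left
        rw [hc u huv.symm, hrf, hrt]
      obtain ⟨i, rfl⟩ := fsurj u hu
      obtain ⟨j, rfl⟩ := fsurj v hv
      exact Or.inr ⟨i, j, rfl, rfl⟩
    have hside : ∀ a b i, i ∈ side (G.comap f) a b ↔ f i ∈ side G (f a) (f b) := by
      intro a b i
      constructor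
      · intro h
        refine reachable_retract f (fun u v huv => Or.inr ?_) h
        rw [SimpleGraph.deleteEdges_adj] at huv ⊢
        refine ⟨huv.1, fun h => huv.2 ?_⟩
        simp only [Set.mem_singleton_iff, Sym2.eq_iff] at h ⊢
        rcases h with ⟨h1, h2⟩ | ⟨h1, h2⟩
        · exact Or.inl ⟨finj h1, finj h2⟩
        · exact Or.inr ⟨finj h1, finj h2⟩
      · intro h
        have := reachable_retract (G' := (G.comap f).deleteEdges {s(a, b)}) r
          (fun u v huv => ?_) h
        · rw [hrf, hrf] at this
          exact this
        rw [SimpleGraph.deleteEdges_adj] at huv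
        rcases hr u v huv.1 with h | ⟨i, j, rfl, rfl⟩
        · exact Or.inl h
        right
        rw [hrf, hrf, SimpleGraph.deleteEdges_adj]
        refine ⟨huv.1, fun h => huv.2 ?_⟩
        simp only [Set.mem_singleton_iff, Sym2.eq_iff] at h ⊢
        rcases h with ⟨rfl, rfl⟩ | ⟨rfl, rfl⟩ <;> simp
    apply ih
    refine ⟨G.comap f, β ∘ f, f ⁻¹' L, ⟨?_, ?_⟩, ?_, ?_, ⟨?_, ?_, ?_⟩, ?_⟩
    · rw [SimpleGraph.connected_iff]
      refine ⟨fun i j => ?_, ⟨c⟩⟩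
      have := reachable_retract (G' := G.comap f) r (fun u v huv => ?_)
        (hT.connected.preconnected (f i) (f j))
      · rwa [hrf, hrf] at this
      rcases hr u v huv with h | ⟨i, j, rfl, rfl⟩
      · exact Or.inl h
      · right; rw [hrf, hrf]; exact huv
    · exact hT.isAcyclic.of_comap ⟨f, finj⟩
    · intro i
      refine le_trans ?_ (hdeg (f i))
      rw [← Set.ncard_image_of_injective _ finj]
      refine Set.ncard_le_ncard ?_ (Set.toFinite _)
      rintro _ ⟨j, hj, rfl⟩
      exact hj
    · intro i hi j hj j' hj'
      exact finj (hL hi hj hj')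
    · intro i hi
      exact hβ.mapsTo hi
    · intro i hi j hj hij
      exact finj (hβ.injOn hi hj hij)
    · intro e he
      obtain ⟨u, hu, rfl⟩ := hβ.surjOn he
      obtain ⟨i, rfl⟩ := fsurj u (fun h => htL (h ▸ hu))
      exact ⟨i, hu, rfl⟩
    · intro a b hab
      convert hw (f a) (f b) hab using 3
      ext e
      constructor
      · rintro ⟨i, ⟨hi, hi'⟩, rfl⟩
        exact ⟨f i, ⟨hi, (hside _ _ _).1 hi'⟩, rfl⟩
      · rintro ⟨u, ⟨hu, hu'⟩, rfl⟩
        obtain ⟨i, rfl⟩ := fsurj u (fun h => htL (h ▸ hu))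
        exact ⟨i, ⟨hu, (hside _ _ _).2 hu'⟩, rfl⟩

/-- Transfer of decompositions along an injection on a subset of the edges. -/
lemma dbwLE_transfer {V : Type} [Finite V] (D D' : Digraph V) (k : ℕ) (E₁ : Set (V × V))
    (hE₁ : E₁ ⊆ D.edgeSet')
    (φ : V × V → V × V) (hφ : Set.BijOn φ E₁ D'.edgeSet') (hne : D'.edgeSet'.Nonempty)
    (hs : ∀ X ⊆ D.edgeSet', (biSep D' (φ '' (X ∩ E₁))).ncard ≤ (biSep D X).ncard)
    (h : dbwLE D k) : dbwLE D' k := by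
  obtain ⟨m, G, β, hT, hdeg, hβ, hw⟩ := h
  apply dbwLE_of_weakDec D' k hne m
  refine ⟨G, φ ∘ β, leaves G ∩ β ⁻¹' E₁, hT, hdeg, Set.inter_subset_left, ⟨?_, ?_, ?_⟩, ?_⟩
  · intro i hi
    exact hφ.mapsTo hi.2
  · intro i hi j hj hij
    exact hβ.injOn hi.1 hj.1 (hφ.injOn hi.2 hj.2 hij)
  · intro e he
    obtain ⟨e', he', rfl⟩ := hφ.surjOn he
    obtain ⟨i, hi, rfl⟩ := hβ.surjOn (hE₁ he')
    exact ⟨i, ⟨hi, he'⟩, rfl⟩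
  · intro a b hab
    refine le_trans (le_of_eq ?_) ((hs (β '' (leaves G ∩ side G a b)) ?_).trans (hw a b hab))
    · congr 2
      ext e
      constructor
      · rintro ⟨i, ⟨⟨h1, h2⟩, h3⟩, rfl⟩
        exact ⟨β i, ⟨⟨i, ⟨h1, h3⟩, rfl⟩, h2⟩, rfl⟩
      · rintro ⟨_, ⟨⟨i, ⟨h1, h3⟩, rfl⟩, h2⟩, rfl⟩
        exact ⟨i, ⟨⟨h1, h2⟩, h3⟩, rfl⟩
    · rintro _ ⟨i, hi, rfl⟩
      exact hβ.mapsTo hi.1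

lemma mem_biSep {V : Type} (D : Digraph V) (X : Set (V × V)) (y : V) :
    y ∈ biSep D X ↔ ∃ x z, D.Adj x y ∧ D.Adj y z ∧ ¬((x, y) ∈ X ↔ (y, z) ∈ X) := by
  constructor
  · rintro (⟨x, z, h1, h2, h3, h4⟩ | ⟨x, z, h1, h2, h3, h4⟩)
    · exact ⟨x, z, h1, h3, by tauto⟩
    · refine ⟨x, z, h1, h3, ?_⟩
      have h5 : (x, y) ∈ X := by
        by_contra h
        exact h2 ⟨h1, h⟩
      have := h4.2
      tauto
  · rintro ⟨x, z, h1, h2, h3⟩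
    by_cases h : (x, y) ∈ X
    · right
      exact ⟨x, z, h1, fun h' => h'.2 h, h2, h2, by tauto⟩
    · left
      exact ⟨x, z, h1, h, h2, by tauto⟩

lemma dbwLE_subgraph {V : Type} [Finite V] (D D' : Digraph V) (k : ℕ)
    (hsub : ∀ ⦃a b⦄, D'.Adj a b → D.Adj a b) (hne : D'.edgeSet'.Nonempty)
    (h : dbwLE D k) : dbwLE D' k := by
  refine dbwLE_transfer D D' k D'.edgeSet' (fun e he => hsub he) id (Set.bijOn_id _) hne ?_ h
  intro X hX
  refine Set.ncard_le_ncard ?_ (Set.toFinite _)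
  intro y hy
  rw [mem_biSep] at hy ⊢
  obtain ⟨x, z, h1, h2, h3⟩ := hy
  refine ⟨x, z, hsub h1, hsub h2, ?_⟩
  have h1' : (x, y) ∈ D'.edgeSet' := h1
  have h2' : (y, z) ∈ D'.edgeSet' := h2
  simpa [h1', h2'] using h3

lemma dbwLE_contract {V : Type} [Finite V] (D : Digraph V) (x y : V) (hb : ButterflyEdge D x y)
    (k : ℕ) (hne : (contractEdge D x y).edgeSet'.Nonempty)
    (h : dbwLE D k) : dbwLE (contractEdge D x y) k := by
  obtain ⟨hxy, hout, hin⟩ := hb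
  by_cases hxy' : x = y
  · subst hxy'
    refine dbwLE_subgraph D _ k ?_ hne h
    rintro a b ⟨ha, hb, a', b', rfl, rfl, hab, -⟩
    have ha' : a' ≠ x := fun h => by simp [h] at ha
    have hb' : b' ≠ x := fun h => by simp [h] at hb
    simpa [ha', hb'] using hab
  set ρ : V → V := fun a => if a = y then x else a with hρ
  have ρy : ρ y = x := by simp [hρ]
  have ρne : ∀ a, a ≠ y → ρ a = a := fun a ha => by simp [hρ, ha]
  have ρney : ∀ a, ρ a ≠ y := by
    intro a
    by_cases ha : a = y
    · rw [ha, ρy]; exact hxy'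
    · rw [ρne a ha]; exact ha
  set E₁ : Set (V × V) := {e | D.Adj e.1 e.2 ∧ ¬ (e.1 = x ∧ e.2 = y)} with hE₁
  have headne : ∀ e ∈ E₁, e.2 ≠ y := fun e he h2 => by
    have h3 := he.1
    rw [h2] at h3
    exact he.2 ⟨hin _ h3, h2⟩
  have tailne : ∀ e ∈ E₁, e.1 ≠ x := fun e he h2 => by
    have h3 := he.1
    rw [h2] at h3
    exact he.2 ⟨h2, hout _ h3⟩
  have ρinj : ∀ a b, a ≠ x → b ≠ x → ρ a = ρ b → a = b := by
    intro a b ha hb hab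
    by_cases h1 : a = y
    · by_cases h2 : b = y
      · rw [h1, h2]
      · rw [h1, ρy, ρne b h2] at hab
        exact (hb hab.symm).elim
    · by_cases h2 : b = y
      · rw [h2, ρy, ρne a h1] at hab
        exact (ha hab).elim
      · rwa [ρne a h1, ρne b h2] at hab
  have hinj : Set.InjOn (fun e : V × V => (ρ e.1, ρ e.2)) E₁ := by
    rintro ⟨a, b⟩ he ⟨a', b'⟩ he' hee
    simp only [Prod.mk.injEq] at hee
    have h1 := ρinj a a' (tailne _ he) (tailne _ he') hee.1
    have h2 := hee.2
    rw [ρne b (headne _ he), ρne b' (headne _ he')] at h2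
    rw [h1, h2]
  refine dbwLE_transfer D _ k E₁ (fun e he => he.1) (fun e => (ρ e.1, ρ e.2))
    ⟨?_, hinj, ?_⟩ hne ?_ h
  · rintro ⟨a, b⟩ he
    exact ⟨ρney _, ρney _, a, b, rfl, rfl, he.1, he.2⟩
  · rintro ⟨a, b⟩ ⟨ha, hb, a', b', h1, h2, h3, h4⟩
    exact ⟨(a', b'), ⟨h3, h4⟩, by simp only [hρ]; exact Prod.ext h1 h2⟩
  intro X hX
  have hmem : ∀ e ∈ E₁, ((ρ e.1, ρ e.2) ∈ (fun e : V × V => (ρ e.1, ρ e.2)) '' (X ∩ E₁) ↔ e ∈ X) := by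
    intro e he
    constructor
    · rintro ⟨e', ⟨h1, h2⟩, h3⟩
      rwa [← hinj h2 he h3]
    · intro h
      exact ⟨e, ⟨h, he⟩, rfl⟩
  have key : ∀ v ∈ biSep (contractEdge D x y) ((fun e : V × V => (ρ e.1, ρ e.2)) '' (X ∩ E₁)),
      ∃ w ∈ biSep D X, ρ w = v := by
    intro v hv
    rw [mem_biSep] at hv
    obtain ⟨p, q, ⟨hp, hvy, a, b, h1, h2, h3, h4⟩, ⟨-, hq, c, d, h5, h6, h7, h8⟩, hX'⟩ := hv
    change ρ a = p at h1
    change ρ b = v at h2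
    change ρ c = v at h5
    change ρ d = q at h6
    have hab : (a, b) ∈ E₁ := ⟨h3, h4⟩
    have hcd : (c, d) ∈ E₁ := ⟨h7, h8⟩
    have e1 := hmem _ hab
    have e2 := hmem _ hcd
    simp only [h1, h2, h5, h6] at e1 e2
    rw [e1, e2] at hX'
    have hbv : b = v := by rw [← h2, ρne b (headne _ hab)]
    subst hbv
    by_cases hc : c = y
    · subst hc
      rw [ρy] at h5
      subst h5
      by_cases hm : (a, x) ∈ X ↔ (x, c) ∈ X
      · refine ⟨c, ?_, ρy⟩
        rw [mem_biSep]
        exact ⟨x, d, hxy, h7, by tauto⟩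
      · refine ⟨x, ?_, ρne _ hvy⟩
        rw [mem_biSep]
        exact ⟨a, c, h3, hxy, hm⟩
    · rw [ρne c hc] at h5
      subst h5
      refine ⟨c, ?_, ρne _ hvy⟩
      rw [mem_biSep]
      exact ⟨a, d, h3, h7, hX'⟩
  refine le_trans (Set.ncard_le_ncard (t := ρ '' biSep D X) ?_ (Set.toFinite _))
    (Set.ncard_image_le (Set.toFinite _))
  intro v hv
  exact key v hv

/-- The binary heap tree on `2n` vertices; the vertex `i` has parent `i / 2`. -/
def heapTree (n : ℕ) : SimpleGraph (Fin (2 * n)) where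
  Adj i j := i ≠ j ∧ (i.val = j.val / 2 ∨ j.val = i.val / 2)
  symm := ⟨fun i j h => ⟨h.1.symm, h.2.symm⟩⟩
  loopless := ⟨fun i h => h.1 rfl⟩

lemma heapTree_connected (n : ℕ) (hn : 0 < n) : (heapTree n).Connected := by
  have key : ∀ a (ha : a < 2 * n), (heapTree n).Reachable ⟨a, ha⟩ ⟨0, by omega⟩ := by
    intro a
    induction a using Nat.strong_induction_on with
    | _ a ih =>
      intro ha
      by_cases h0 : a = 0
      · subst h0; exact SimpleGraph.Reachable.refl _
      · have hadj : (heapTree n).Adj ⟨a, ha⟩ ⟨a / 2, by omega⟩ :=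
          ⟨by simp only [ne_eq, Fin.mk.injEq]; omega, Or.inr rfl⟩
        exact hadj.reachable.trans (ih (a / 2) (by omega) _)
  rw [SimpleGraph.connected_iff]
  exact ⟨fun i j => (key i.1 i.2).trans (key j.1 j.2).symm, ⟨⟨0, by omega⟩⟩⟩

lemma heapTree_isTree (n : ℕ) (hn : 0 < n) : (heapTree n).IsTree := by
  rw [SimpleGraph.isTree_iff_connected_and_card]
  have hc := heapTree_connected n hn
  refine ⟨hc, le_antisymm ?_ hc.card_vert_le_card_edgeSet_add_one⟩
  have hsub : (heapTree n).edgeSet ⊆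
      (fun i : Fin (2 * n) => s(i, ⟨i.1 / 2, by omega⟩)) '' {⟨0, by omega⟩}ᶜ := by
    intro e
    induction e with
    | h i j =>
      intro h
      obtain ⟨hne, h | h⟩ := (SimpleGraph.mem_edgeSet _).1 h
      · refine ⟨j, ?_, ?_⟩
        · rintro rfl
          exact hne (Fin.ext (by simpa using h))
        · have h' : (⟨j.1 / 2, by omega⟩ : Fin (2 * n)) = i := Fin.ext h.symm
          simp only [h']
          exact Sym2.eq_swap
      · refine ⟨i, ?_, ?_⟩
        · rintro rfl
          exact hne (Fin.ext (by simpa using h.symm))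
        · have h' : (⟨i.1 / 2, by omega⟩ : Fin (2 * n)) = j := Fin.ext h.symm
          simp only [h']
  have h1 := (Set.ncard_le_ncard hsub (Set.toFinite _)).trans
    (Set.ncard_image_le (Set.toFinite _))
  rw [Set.ncard_compl, Set.ncard_singleton, Nat.card_fin] at h1
  rw [Nat.card_coe_set_eq, Nat.card_fin]
  omega

lemma exists_dbwLE {V : Type} [Finite V] (D : Digraph V) (hne : D.edgeSet'.Nonempty) :
    ∃ k, dbwLE D k := by
  obtain ⟨n, ⟨e⟩⟩ := Finite.exists_equiv_fin D.edgeSet'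
  obtain ⟨e₀, he₀⟩ := hne
  have hn : 0 < n := by have := (e ⟨e₀, he₀⟩).2; omega
  refine ⟨(Set.univ : Set V).ncard, dbwLE_of_weakDec D _ ⟨e₀, he₀⟩ (2 * n) ?_⟩
  refine ⟨heapTree n, fun i => if h : n ≤ i.1 then (e.symm ⟨i.1 - n, by omega⟩).1 else e₀,
    {i | n ≤ i.1}, heapTree_isTree n hn, ?_, ?_, ⟨?_, ?_, ?_⟩, ?_⟩
  · intro i
    rw [← Set.ncard_image_of_injective _ Fin.val_injective]
    refine le_trans (Set.ncard_le_ncard (t := {i.1 / 2, 2 * i.1, 2 * i.1 + 1}) ?_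
      (Set.toFinite _)) ?_
    · rintro _ ⟨j, ⟨-, hj⟩, rfl⟩
      simp only [Set.mem_insert_iff, Set.mem_singleton_iff]
      omega
    · refine (Set.ncard_insert_le _ _).trans ?_
      have := Set.ncard_insert_le (2 * i.1) {2 * i.1 + 1}
      rw [Set.ncard_singleton] at this
      omega
  · intro i hi j hj j' hj'
    obtain ⟨h1, h2⟩ := hj
    obtain ⟨h3, h4⟩ := hj'
    have := j.2
    have := j'.2
    have hi' : n ≤ i.1 := hi
    apply Fin.ext
    omega
  · intro i hi
    have hi' : n ≤ i.1 := hi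
    simp only [hi', dif_pos]
    exact (e.symm _).2
  · intro i hi j hj hij
    have hi' : n ≤ i.1 := hi
    have hj' : n ≤ j.1 := hj
    simp only [hi', hj', dif_pos] at hij
    have := e.symm.injective (Subtype.ext hij)
    simp only [Fin.mk.injEq] at this
    apply Fin.ext
    omega
  · intro d hd
    refine ⟨⟨n + (e ⟨d, hd⟩).1, by omega⟩, ?_, ?_⟩
    · simp
    · simp
  · intro a b _
    exact Set.ncard_le_ncard (Set.subset_univ _) (Set.toFinite _)

/-- If `H` is a butterfly minor of `D`, then `dbw(H) ≤ dbw(D)`. -/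
theorem dbw_le_of_butterflyMinor {V : Type} [Fintype V] (H D : Digraph V)
    (h : ButterflyMinor H D) : dbw H ≤ dbw D := by
  obtain ⟨D₀, hsub, hred⟩ := h
  by_cases hH : H.edgeSet'.Nonempty
  · have key : ∀ k, D₀.edgeSet'.Nonempty → dbwLE D₀ k →
        ∀ H', Relation.ReflTransGen butterflyStep D₀ H' → H'.edgeSet'.Nonempty → dbwLE H' k := by
      intro k _ h0 H' hr
      induction hr with
      | refl => exact fun _ => h0
      | tail _ hst ih =>
        obtain ⟨x, y, hb, rfl⟩ := hst
        intro hne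
        exact dbwLE_contract _ x y hb k hne (ih ⟨(x, y), hb.1⟩)
    have hD₀ : D₀.edgeSet'.Nonempty := by
      rcases Relation.ReflTransGen.cases_head hred with h | ⟨c, ⟨x, y, hb, -⟩, -⟩
      · rw [h]; exact hH
      · exact ⟨(x, y), hb.1⟩
    have hD : D.edgeSet'.Nonempty := hD₀.mono (fun e he => hsub he)
    have hmem : dbwLE D (dbw D) := Nat.sInf_mem (exists_dbwLE D hD)
    exact Nat.sInf_le (key _ hD₀ (dbwLE_subgraph D D₀ _ hsub hD₀ hmem) H hred hH)
  · have h0 : dbw H = 0 := by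
      by_cases hk : ∃ k, dbwLE H k
      · obtain ⟨k, m, G, β, h1, h2, h3, h4⟩ := hk
        refine Nat.le_zero.1 (Nat.sInf_le ⟨m, G, β, h1, h2, h3, fun a b _ => ?_⟩)
        refine le_of_eq ((Set.ncard_eq_zero (Set.toFinite _)).2 ?_)
        rw [Set.eq_empty_iff_forall_notMem]
        intro v hv
        rw [mem_biSep] at hv
        obtain ⟨x, z, hx, -⟩ := hv
        exact hH ⟨(x, v), hx⟩
      · unfold dbw
        rw [Nat.sInf_eq_zero]
        right
        rw [Set.eq_empty_iff_forall_notMem]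
        exact fun k hk' => hk ⟨k, hk'⟩
    rw [h0]
    exact Nat.zero_le _
end
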